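/- arXiv:2309.12874 — 2 statements merged into one kernel-verified Lean document; each statement's English description precedes it below -/
import Mathlib

section
/- For every integer m ≥ 1 and every p ∈ [1,∞) there exists a constant C = C(m,p) ∈ (0,∞) such that for every compact metric space (N,d), every Borel measurable map u : ℝ^m → N, every λ ∈ [2,∞) and every δ ∈ [0,∞), one has ∫_1^λ Σ_{k∈ℤ} ∫_{[0,1]^m} Σ_{j∈ℤ^m} sup{ MO_{δ,p}u(x', x_{m+1}) : x' ∈ ∂(τλ^{−k}([0,1]^m + j + h)) and x_{m+1} ∈ [τλ^{−k}/(λ−1), τλ^{−(k−1)}/(λ−1)] } dh (dτ/τ) ≤ C · ∬_{ℝ^m×ℝ^m} (d(u(y),u(z)) − δ/2)_+^p / |y−z|^{2m} dy dz, where ∂ denotes the topological boundary of the cube in ℝ^m. -/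
open MeasureTheory Metric Set
open scoped ENNReal Topology

noncomputable section

abbrev Euc (m : ℕ) : Type := EuclideanSpace ℝ (Fin m)

/-- Truncated mean oscillation `MO_{δ,p} u (x', r)` of a map `u : ℝ^m → N`:
the double average over the ball of radius `r` centered at `x'` of
`(d(u y, u z) - δ)₊ ^ p`. -/
def MO {N : Type} [PseudoMetricSpace N] {m : ℕ} (p δ : ℝ) (u : Euc m → N)
    (x' : Euc m) (r : ℝ) : ℝ≥0∞ :=
  (volume (ball x' r))⁻¹ * (volume (ball x' r))⁻¹ *
    ∫⁻ y in ball x' r, ∫⁻ z in ball x' r,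
      ENNReal.ofReal (max (dist (u y) (u z) - δ) 0 ^ p)

/-- Truncated Gagliardo energy `∬ (d(u y, u z) - δ)₊^p / |y-z|^{2m}`. -/
def truncGagliardo {N : Type} [PseudoMetricSpace N] {m : ℕ} (p δ : ℝ)
    (u : Euc m → N) : ℝ≥0∞ :=
  ∫⁻ y, ∫⁻ z, ENNReal.ofReal (max (dist (u y) (u z) - δ) 0 ^ p) /
    ENNReal.ofReal (dist y z ^ (2 * m))

/-- The cube `r·([0,1]^m + c)` of edge length `r` in `ℝ^m`. -/
def cube (m : ℕ) (r : ℝ) (c : Fin m → ℝ) : Set (Euc m) :=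
  {x | ∀ i, x i ∈ Icc (r * c i) (r * (c i + 1))}


/-- Summing the integrals over integer translates of the unit cube recovers the full integral. -/
lemma lintegral_Icc_tsum_translates {m : ℕ} {f : (Fin m → ℝ) → ℝ≥0∞} (hf : Measurable f) :
    ∫⁻ h in Icc (0 : Fin m → ℝ) 1, ∑' j : Fin m → ℤ, f (fun i => (j i : ℝ) + h i)
      = ∫⁻ c, f c := by
  have hdisj : Pairwise (Function.onFun Disjoint
      fun j : Fin m → ℤ => univ.pi fun i => Ico (j i : ℝ) (j i + 1)) := by
    intro j j' hj
    obtain ⟨i, hi⟩ := Function.ne_iff.1 hj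
    exact Set.disjoint_univ_pi.2 ⟨i, pairwise_disjoint_Ico_intCast ℝ hi⟩
  have hcover : ⋃ j : Fin m → ℤ, univ.pi (fun i => Ico (j i : ℝ) (j i + 1)) = univ :=
    eq_univ_of_forall fun x => mem_iUnion.2
      ⟨fun i => ⌊x i⌋, fun i _ => ⟨Int.floor_le _, Int.lt_floor_add_one _⟩⟩
  have hmeas (j : Fin m → ℤ) : Measurable fun h : Fin m → ℝ => f fun i => (j i : ℝ) + h i :=
    hf.comp (measurable_const_add _)
  rw [lintegral_tsum fun j => (hmeas j).aemeasurable, ← setLIntegral_univ f,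
    ← hcover, lintegral_iUnion (fun j => MeasurableSet.univ_pi fun i => measurableSet_Ico) hdisj]
  refine tsum_congr fun j => ?_
  have htrans := (measurePreserving_add_left volume (fun i => (j i : ℝ))).setLIntegral_comp_preimage
    (s := Icc (fun i => (j i : ℝ)) (fun i => (j i : ℝ) + 1)) measurableSet_Icc hf
  have hae : (univ.pi fun i => Ico (j i : ℝ) (j i + 1)) =ᵐ[volume]
      Icc (fun i => (j i : ℝ)) (fun i => (j i : ℝ) + 1) := Measure.univ_pi_Ico_ae_eq_Icc
  rw [setLIntegral_congr hae, ← htrans]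
  congr 2
  ext h
  simp [Set.mem_Icc, Pi.le_def]

/-- Decomposition of `(0, ∞)` with measure `dr / r` into the geometric shells
`(λ^{-k}, λ^{-k+1}]`. -/
lemma lintegral_tsum_zpow_le {lam : ℝ} (hlam : 1 < lam) {g : ℝ → ℝ≥0∞} (hg : Measurable g) :
    ∫⁻ τ in Ioc 1 lam, (∑' k : ℤ, g (τ * lam ^ (-k))) * ENNReal.ofReal τ⁻¹
      ≤ ∫⁻ r in Ioi 0, g r * ENNReal.ofReal r⁻¹ := by
  have hpos : 0 < lam := by linarith
  have hshell (k : ℤ) : ∫⁻ τ in Ioc 1 lam, g (τ * lam ^ (-k)) * ENNReal.ofReal τ⁻¹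
      = ∫⁻ r in Ioc (lam ^ (-k)) (lam ^ (-k + 1)), g r * ENNReal.ofReal r⁻¹ := by
    have hb : 0 < lam ^ (-k) := by positivity
    have himage : (fun x => x * lam ^ (-k)) '' Ioc 1 lam
        = Ioc (lam ^ (-k)) (lam ^ (-k + 1)) := by
      rw [image_mul_right_Ioc _ _ hb, one_mul, zpow_add_one₀ hpos.ne', mul_comm lam]
    rw [← himage, lintegral_image_eq_lintegral_abs_deriv_mul measurableSet_Ioc
      (fun x _ => (hasDerivAt_mul_const (lam ^ (-k))).hasDerivWithinAt)
      (mul_left_injective₀ hb.ne').injOn]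
    refine setLIntegral_congr_fun measurableSet_Ioc fun τ hτ => ?_
    have hτ0 : 0 < τ := by linarith [hτ.1]
    simp only [abs_of_pos hb]
    rw [mul_left_comm, ← ENNReal.ofReal_mul hb.le]
    congr 2
    field_simp
  have hdisj : Pairwise (Function.onFun Disjoint
      fun k : ℤ => Ioc (lam ^ (-k)) (lam ^ (-k + 1))) := by
    intro k l hkl
    refine Set.disjoint_left.2 fun x hk hl => hkl ?_
    have h₁ := (zpow_lt_zpow_iff_right₀ hlam).1 (hk.1.trans_le hl.2)
    have h₂ := (zpow_lt_zpow_iff_right₀ hlam).1 (hl.1.trans_le hk.2)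
    omega
  calc ∫⁻ τ in Ioc 1 lam, (∑' k : ℤ, g (τ * lam ^ (-k))) * ENNReal.ofReal τ⁻¹
      = ∑' k : ℤ, ∫⁻ τ in Ioc 1 lam, g (τ * lam ^ (-k)) * ENNReal.ofReal τ⁻¹ := by
        rw [← lintegral_tsum fun k => by fun_prop]
        simp_rw [ENNReal.tsum_mul_right]
    _ = ∫⁻ r in ⋃ k : ℤ, Ioc (lam ^ (-k)) (lam ^ (-k + 1)), g r * ENNReal.ofReal r⁻¹ := by
        rw [lintegral_iUnion (fun k => measurableSet_Ioc) hdisj]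
        exact tsum_congr hshell
    _ ≤ _ := lintegral_mono_set <| iUnion_subset fun k x hx =>
        (zpow_pos hpos (-k)).trans hx.1

/-- A majorant, in terms of the relative position `v` of a point in a unit cube, for the kernel
of the mean oscillation over balls centered on the boundary of the cube. -/
def boundaryWeight {m : ℕ} (s : ℝ) (v : Fin m → ℝ) : ℝ :=
  ∑ i, ∑ e : Fin 2, ∏ l, if l = i then (1 + ((v l - (e : ℕ)) / s) ^ 2)⁻¹
    else (Icc (-2 : ℝ) 3).indicator 1 (v l)

lemma boundaryWeight_term_nonneg {m : ℕ} (s : ℝ) (v : Fin m → ℝ) (i : Fin m) (e : Fin 2) :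
    0 ≤ ∏ l, if l = i then (1 + ((v l - (e : ℕ)) / s) ^ 2)⁻¹
      else (Icc (-2 : ℝ) 3).indicator 1 (v l) := by
  refine Finset.prod_nonneg fun l _ => ?_
  split_ifs
  · positivity
  · exact indicator_nonneg (fun _ _ => zero_le_one) _

lemma boundaryWeight_nonneg {m : ℕ} (s : ℝ) (v : Fin m → ℝ) : 0 ≤ boundaryWeight s v :=
  Finset.sum_nonneg fun i _ => Finset.sum_nonneg fun e _ => boundaryWeight_term_nonneg s v i e

lemma le_boundaryWeight {m : ℕ} (s : ℝ) {v : Fin m → ℝ} (hv : ∀ l, v l ∈ Icc (-2 : ℝ) 3)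
    (i : Fin m) (e : Fin 2) :
    (1 + ((v i - (e : ℕ)) / s) ^ 2)⁻¹ ≤ boundaryWeight s v := by
  have hterm : (∏ l, if l = i then (1 + ((v l - (e : ℕ)) / s) ^ 2)⁻¹
      else (Icc (-2 : ℝ) 3).indicator 1 (v l)) = (1 + ((v i - (e : ℕ)) / s) ^ 2)⁻¹ := by
    simp_rw [indicator_of_mem (hv _), Pi.one_apply]
    rw [Finset.prod_ite_eq' Finset.univ i]
    simp
  rw [← hterm]
  refine (Finset.single_le_sum (fun e _ => boundaryWeight_term_nonneg s v i e)
    (Finset.mem_univ e)).trans ?_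
  exact Finset.single_le_sum (f := fun i => ∑ e : Fin 2, _)
    (fun i _ => Finset.sum_nonneg fun e _ => boundaryWeight_term_nonneg s v i e)
    (Finset.mem_univ i)

lemma measurable_boundaryWeight (m : ℕ) :
    Measurable fun q : ℝ × (Fin m → ℝ) => boundaryWeight q.1 q.2 := by
  have hind : Measurable ((Icc (-2 : ℝ) 3).indicator (1 : ℝ → ℝ)) :=
    measurable_const.indicator measurableSet_Icc
  unfold boundaryWeight
  refine Finset.measurable_sum _ fun i _ => Finset.measurable_sum _ fun e _ =>
    Finset.measurable_prod _ fun l _ => ?_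
  split_ifs
  · fun_prop
  · exact hind.comp (by fun_prop)

lemma lintegral_boundaryWeight {m : ℕ} {s : ℝ} (hs : 0 < s) :
    ∫⁻ v : Fin m → ℝ, ENNReal.ofReal (boundaryWeight s v)
      = ENNReal.ofReal (2 * m * 5 ^ (m - 1) * Real.pi * s) := by
  have hcauchy (e : ℝ) : Integrable fun x : ℝ => (1 + ((x - e) / s) ^ 2)⁻¹ :=
    (integrable_inv_one_add_sq.comp_div hs.ne').comp_sub_right e
  have hcauchy_int (e : ℝ) : ∫ x : ℝ, (1 + ((x - e) / s) ^ 2)⁻¹ = Real.pi * s := by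
    rw [integral_sub_right_eq_self (fun x : ℝ => (1 + (x / s) ^ 2)⁻¹),
      Measure.integral_comp_div (fun x : ℝ => (1 + x ^ 2)⁻¹), integral_univ_inv_one_add_sq,
      abs_of_pos hs, smul_eq_mul, mul_comm]
  have hfactor (i : Fin m) (e : Fin 2) (l : Fin m) : Integrable fun x : ℝ =>
      if l = i then (1 + ((x - (e : ℕ)) / s) ^ 2)⁻¹ else (Icc (-2 : ℝ) 3).indicator 1 x := by
    split_ifs
    · exact hcauchy _
    · exact (integrable_indicator_iff measurableSet_Icc).2 (integrableOn_const (by simp))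
  have hterm (i : Fin m) (e : Fin 2) : Integrable fun v : Fin m → ℝ =>
      ∏ l, if l = i then (1 + ((v l - (e : ℕ)) / s) ^ 2)⁻¹
        else (Icc (-2 : ℝ) 3).indicator 1 (v l) :=
    Integrable.fintype_prod (hfactor i e)
  have hterm_int (i : Fin m) (e : Fin 2) : ∫ v : Fin m → ℝ,
      (∏ l, if l = i then (1 + ((v l - (e : ℕ)) / s) ^ 2)⁻¹
        else (Icc (-2 : ℝ) 3).indicator 1 (v l)) = 5 ^ (m - 1) * (Real.pi * s) := by
    rw [integral_fintype_prod_volume_eq_prod (f := fun (l : Fin m) (x : ℝ) =>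
      if l = i then (1 + ((x - (e : ℕ)) / s) ^ 2)⁻¹ else (Icc (-2 : ℝ) 3).indicator 1 x),
      ← Finset.prod_erase_mul _ _ (Finset.mem_univ i)]
    have hrest : ∀ l ∈ Finset.univ.erase i, (∫ x : ℝ, if l = i then
        (1 + ((x - (e : ℕ)) / s) ^ 2)⁻¹ else (Icc (-2 : ℝ) 3).indicator 1 x) = 5 := by
      intro l hl
      simp only [if_neg (Finset.ne_of_mem_erase hl)]
      rw [integral_indicator_one measurableSet_Icc, Real.volume_real_Icc]
      norm_num
    rw [Finset.prod_congr rfl hrest]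
    simp [hcauchy_int]
  have hint : Integrable fun v : Fin m → ℝ => boundaryWeight s v :=
    integrable_finsetSum _ fun i _ => integrable_finsetSum _ fun e _ => hterm i e
  rw [← ofReal_integral_eq_lintegral_ofReal hint
    (Filter.Eventually.of_forall (boundaryWeight_nonneg s))]
  unfold boundaryWeight
  rw [integral_finsetSum _ fun i _ => integrable_finsetSum _ fun e _ => hterm i e]
  simp_rw [integral_finsetSum _ fun e _ => hterm _ e, hterm_int]
  congr 1
  simp
  ring

lemma exists_coord_eq_of_mem_frontier_cube {m : ℕ} {r : ℝ} {c : Fin m → ℝ} {x : Euc m}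
    (hx : x ∈ frontier (cube m r c)) :
    x ∈ cube m r c ∧ ∃ (i : Fin m) (e : Fin 2), x i = r * (c i + (e : ℕ)) := by
  have hclosed : IsClosed (cube m r c) := by
    simp only [cube, ofPred_forall]
    exact isClosed_iInter fun i => isClosed_Icc.preimage (by fun_prop)
  have hmem : x ∈ cube m r c := hclosed.frontier_subset hx
  refine ⟨hmem, ?_⟩
  by_contra! hne
  have hopen : IsOpen {y : Euc m | ∀ i, y i ∈ Ioo (r * c i) (r * (c i + 1))} := by
    simp only [ofPred_forall]
    exact isOpen_iInter_of_finite fun i => isOpen_Ioo.preimage (by fun_prop)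
  refine hx.2 (mem_interior.2 ⟨_, fun y (hy : ∀ i, y i ∈ Ioo (r * c i) (r * (c i + 1))) i =>
    Ioo_subset_Icc_self (hy i), hopen, fun i => ⟨?_, ?_⟩⟩)
  · exact (hmem i).1.lt_of_ne fun h => hne i 0 (by simpa using h.symm)
  · exact (hmem i).2.lt_of_ne fun h => hne i 1 (by simpa using h)

lemma lintegral_scale_le {q : ℝ} (hq : 0 ≤ q) :
    ∫⁻ r in Ioi 0, ENNReal.ofReal (if q < 4 * r then q / r else 0) * ENNReal.ofReal r⁻¹
      ≤ ENNReal.ofReal 4 := by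
  rcases hq.eq_or_lt with rfl | hq
  · simp
  have hq4 : 0 < q / 4 := by positivity
  have hint : IntegrableOn (fun r : ℝ => q * r ^ (-2 : ℝ)) (Ioi (q / 4)) :=
    (integrableOn_Ioi_rpow_of_lt (by norm_num) hq4).const_mul q
  have hval : ∫ r in Ioi (q / 4), q * r ^ (-2 : ℝ) = 4 := by
    rw [integral_const_mul, integral_Ioi_rpow_of_lt (by norm_num) hq4]
    norm_num [Real.rpow_neg_one]
    field_simp
  have hval' : ENNReal.ofReal 4 = ∫⁻ r in Ioi (q / 4), ENNReal.ofReal (q * r ^ (-2 : ℝ)) := by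
    refine (congrArg ENNReal.ofReal hval.symm).trans ?_
    refine ofReal_integral_eq_lintegral_ofReal hint
      ((ae_restrict_iff' measurableSet_Ioi).2 (Filter.Eventually.of_forall fun r hr => ?_))
    have : 0 < r := hq4.trans hr
    simp only [Pi.zero_apply]
    positivity
  rw [hval', ← lintegral_indicator measurableSet_Ioi, ← lintegral_indicator measurableSet_Ioi]
  refine lintegral_mono fun r => ?_
  by_cases hr : 0 < r
  · rw [indicator_of_mem (by exact hr)]
    by_cases hqr : q < 4 * r
    · rw [indicator_of_mem (by simp only [mem_Ioi]; linarith), if_pos hqr,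
        ← ENNReal.ofReal_mul (by positivity), Real.rpow_neg hr.le]
      apply ENNReal.ofReal_le_ofReal
      norm_num
      field_simp
      rfl
    · simp [if_neg hqr]
  · rw [indicator_of_notMem (by exact hr)]
    exact zero_le

/-- The integrand of the truncated Gagliardo energy as a function of a pair of points. -/
def gagliardoDensity {N : Type} [PseudoMetricSpace N] {m : ℕ} (p δ : ℝ) (u : Euc m → N)
    (z : Euc m × Euc m) : ℝ≥0∞ :=
  ENNReal.ofReal (max (dist (u z.1) (u z.2) - δ) 0 ^ p) / ENNReal.ofReal (dist z.1 z.2 ^ (2 * m))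

/-- The kernel that controls mean oscillations over balls centered on the boundary of the cube
`r·([0,1]^m + c)`. -/
def boundaryKernel {m : ℕ} (r : ℝ) (c : Fin m → ℝ) (z : Euc m × Euc m) : ℝ :=
  if dist z.1 z.2 < 4 * r then boundaryWeight (dist z.1 z.2 / r) (fun l => z.1 l / r - c l) else 0

lemma measurable_boundaryKernel {m : ℕ} (r : ℝ) :
    Measurable fun q : (Fin m → ℝ) × (Euc m × Euc m) => boundaryKernel r q.1 q.2 := by
  unfold boundaryKernel
  refine Measurable.ite (measurableSet_lt (by fun_prop) (by fun_prop)) ?_ measurable_const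
  have hpos : Measurable fun q : (Fin m → ℝ) × (Euc m × Euc m) =>
      (dist q.2.1 q.2.2 / r, fun l => q.2.1 l / r - q.1 l) :=
    Measurable.prodMk (by fun_prop) (measurable_pi_lambda _ fun l => by fun_prop)
  have hcomp := (measurable_boundaryWeight m).comp hpos
  exact hcomp

lemma measurable_gagliardoDensity {N : Type} [MetricSpace N] [CompactSpace N] [MeasurableSpace N]
    [BorelSpace N] {m : ℕ} (p δ : ℝ) {u : Euc m → N} (hu : Measurable u) :
    Measurable (gagliardoDensity p δ u) := by
  have hdist : Measurable fun z : Euc m × Euc m => dist (u z.1) (u z.2) :=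
    (hu.comp measurable_fst).dist (hu.comp measurable_snd)
  unfold gagliardoDensity
  fun_prop

lemma lintegral_gagliardoDensity {N : Type} [MetricSpace N] [CompactSpace N] [MeasurableSpace N]
    [BorelSpace N] {m : ℕ} (p δ : ℝ) {u : Euc m → N} (hu : Measurable u) :
    ∫⁻ z, gagliardoDensity p δ u z = truncGagliardo p δ u :=
  lintegral_prod _ (measurable_gagliardoDensity p δ hu).aemeasurable

lemma gagliardoDensity_of_dist_eq_zero {N : Type} [PseudoMetricSpace N] {m : ℕ} {p δ : ℝ}
    (hp : 0 < p) (hδ : 0 ≤ δ) (u : Euc m → N) {z : Euc m × Euc m} (hz : dist z.1 z.2 = 0) :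
    gagliardoDensity p δ u z = 0 := by
  simp [gagliardoDensity, dist_eq_zero.1 hz, hδ, Real.zero_rpow hp.ne']

lemma inv_pow_le_mul_inv_one_add_sq {m : ℕ} (hm : 1 ≤ m) {t q a : ℝ} (hq : 0 < q)
    (hqt : q ≤ 2 * t) (hat : |a| ≤ t) :
    (t ^ m)⁻¹ * (t ^ m)⁻¹ ≤ 4 ^ m * (5 / 4) * (q ^ (2 * m))⁻¹ * (1 + (a / q) ^ 2)⁻¹ := by
  obtain ⟨n, rfl⟩ := Nat.exists_eq_add_of_le' hm
  have ht : 0 < t := by linarith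
  have hq2 : q ^ 2 ≤ 4 * t ^ 2 := by nlinarith
  have ha2 : a ^ 2 ≤ t ^ 2 := sq_le_sq' (abs_le.1 hat).1 (abs_le.1 hat).2
  have hmain : (q ^ 2) ^ n * (q ^ 2 + a ^ 2) ≤ (4 * t ^ 2) ^ n * (5 * t ^ 2) := by
    gcongr
    linarith
  have hrhs : 4 ^ (n + 1) * (5 / 4) * (q ^ (2 * (n + 1)))⁻¹ * (1 + (a / q) ^ 2)⁻¹
      = 4 ^ n * 5 / ((q ^ 2) ^ n * (q ^ 2 + a ^ 2)) := by
    rw [pow_mul, pow_succ (q ^ 2), pow_succ (4 : ℝ)]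
    field_simp
  rw [hrhs, ← mul_inv, inv_eq_one_div, div_le_div_iff₀ (by positivity) (by positivity)]
  calc 1 * ((q ^ 2) ^ n * (q ^ 2 + a ^ 2)) ≤ (4 * t ^ 2) ^ n * (5 * t ^ 2) := by simpa using hmain
    _ = _ := by rw [mul_pow]; ring

/-- The real kernel of the mean oscillation over a ball centered at a boundary point of a cube is
dominated by the boundary kernel of that cube. -/
lemma inv_pow_le_boundaryKernel {m : ℕ} (hm : 1 ≤ m) {r t : ℝ} (hr : 0 < r) (htr : t ≤ 2 * r)
    {c : Fin m → ℝ} {x : Euc m} (hx : x ∈ frontier (cube m r c)) {z : Euc m × Euc m}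
    (hz : z ∈ ball x t ×ˢ ball x t) (hd : 0 < dist z.1 z.2) :
    (t ^ m)⁻¹ * (t ^ m)⁻¹
      ≤ 4 ^ m * (5 / 4) * (dist z.1 z.2 ^ (2 * m))⁻¹ * boundaryKernel r c z := by
  obtain ⟨hmem, i, e, hi⟩ := exists_coord_eq_of_mem_frontier_cube hx
  have hz1 : dist z.1 x < t := hz.1
  have hz2 : dist z.2 x < t := hz.2
  have hdt : dist z.1 z.2 < 2 * t := by linarith [dist_triangle_right z.1 z.2 x]
  have hcoord (l : Fin m) : |z.1 l - x l| < t := by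
    refine lt_of_le_of_lt ?_ hz1
    rw [dist_eq_norm]
    exact PiLp.norm_apply_le (z.1 - x) l
  have hbox (l : Fin m) : z.1 l / r - c l ∈ Icc (-2 : ℝ) 3 := by
    obtain ⟨h₁, h₂⟩ := abs_lt.1 (hcoord l)
    obtain ⟨h₃, h₄⟩ := hmem l
    constructor
    · rw [le_sub_iff_add_le, le_div_iff₀ hr]
      nlinarith
    · rw [sub_le_iff_le_add, div_le_iff₀ hr]
      nlinarith
  rw [boundaryKernel, if_pos (by linarith)]
  refine (inv_pow_le_mul_inv_one_add_sq hm hd hdt.le (hcoord i).le).trans ?_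
  have hrel : (z.1 i / r - c i - (e : ℕ)) / (dist z.1 z.2 / r) = (z.1 i - x i) / dist z.1 z.2 := by
    rw [hi]
    field_simp
    ring
  have := le_boundaryWeight (dist z.1 z.2 / r) hbox i e
  rw [hrel] at this
  gcongr

lemma MO_le_lintegral_boundaryKernel {N : Type} [MetricSpace N] [CompactSpace N]
    [MeasurableSpace N] [BorelSpace N] {m : ℕ} (hm : 1 ≤ m) {p δ δ' : ℝ} (hp : 0 < p)
    (hδ' : 0 ≤ δ') (hδ : δ' ≤ δ) {u : Euc m → N} (hu : Measurable u) {r t : ℝ} (hr : 0 < r)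
    (ht : 0 < t) (htr : t ≤ 2 * r) {c : Fin m → ℝ} {x : Euc m}
    (hx : x ∈ frontier (cube m r c)) :
    MO p δ u x t ≤ (volume (ball (0 : Euc m) 1))⁻¹ * (volume (ball (0 : Euc m) 1))⁻¹
      * ENNReal.ofReal (4 ^ m * (5 / 4))
      * ∫⁻ z, gagliardoDensity p δ' u z * ENNReal.ofReal (boundaryKernel r c z) := by
  set V := volume (ball (0 : Euc m) 1)
  have hdist : Measurable fun z : Euc m × Euc m => dist (u z.1) (u z.2) :=
    (hu.comp measurable_fst).dist (hu.comp measurable_snd)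
  have hosc : Measurable fun z : Euc m × Euc m =>
      ENNReal.ofReal (max (dist (u z.1) (u z.2) - δ) 0 ^ p) := by fun_prop
  have hV : (volume (ball x t))⁻¹ = V⁻¹ * ENNReal.ofReal (t ^ m)⁻¹ := by
    rw [Measure.addHaar_ball_of_pos _ _ ht, finrank_euclideanSpace_fin, mul_comm,
      ENNReal.mul_inv (Or.inr ENNReal.ofReal_ne_top)
        (Or.inr (ENNReal.ofReal_pos.2 (by positivity)).ne'),
      ENNReal.ofReal_inv_of_pos (by positivity)]
  have hsplit : (volume (ball x t))⁻¹ * (volume (ball x t))⁻¹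
      = V⁻¹ * V⁻¹ * ENNReal.ofReal ((t ^ m)⁻¹ * (t ^ m)⁻¹) := by
    rw [hV, ENNReal.ofReal_mul (by positivity)]
    ring
  have hprod : ∫⁻ y in ball x t, ∫⁻ z in ball x t,
        ENNReal.ofReal (max (dist (u y) (u z) - δ) 0 ^ p)
      = ∫⁻ z in ball x t ×ˢ ball x t,
        ENNReal.ofReal (max (dist (u z.1) (u z.2) - δ) 0 ^ p) :=
    (setLIntegral_prod _ hosc.aemeasurable).symm
  rw [MO, hsplit, hprod, mul_assoc, mul_assoc (V⁻¹ * V⁻¹), ← lintegral_const_mul _ hosc,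
    ← lintegral_const_mul' _ _ ENNReal.ofReal_ne_top]
  refine mul_le_mul' le_rfl ?_
  have hball : MeasurableSet (ball x t) := measurableSet_ball
  refine (setLIntegral_mono' (hball.prod hball) fun z hz => ?_).trans
    (setLIntegral_le_lintegral _ _)
  rcases dist_nonneg.eq_or_lt' (a := dist z.1 z.2) with hd | hd
  · have hzero : max (dist (u z.1) (u z.2) - δ) 0 = 0 := by
      simpa [dist_eq_zero.1 hd] using hδ'.trans hδ
    simp [hzero, Real.zero_rpow hp.ne']
  calc ENNReal.ofReal ((t ^ m)⁻¹ * (t ^ m)⁻¹)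
        * ENNReal.ofReal (max (dist (u z.1) (u z.2) - δ) 0 ^ p)
      ≤ ENNReal.ofReal (4 ^ m * (5 / 4) * (dist z.1 z.2 ^ (2 * m))⁻¹ * boundaryKernel r c z)
        * ENNReal.ofReal (max (dist (u z.1) (u z.2) - δ') 0 ^ p) := by
        refine mul_le_mul'
          (ENNReal.ofReal_le_ofReal (inv_pow_le_boundaryKernel hm hr htr hx hz hd)) ?_
        gcongr
    _ = _ := by
        rw [gagliardoDensity, ENNReal.ofReal_mul (by positivity), ENNReal.ofReal_mul (by positivity),
          ENNReal.ofReal_inv_of_pos (by positivity), ENNReal.div_eq_inv_mul]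
        ring

lemma lintegral_boundaryKernel {m : ℕ} {r : ℝ} (hr : 0 < r) {z : Euc m × Euc m}
    (hz : 0 < dist z.1 z.2) :
    ∫⁻ c, ENNReal.ofReal (boundaryKernel r c z)
      = ENNReal.ofReal (2 * m * 5 ^ (m - 1) * Real.pi)
        * ENNReal.ofReal (if dist z.1 z.2 < 4 * r then dist z.1 z.2 / r else 0) := by
  unfold boundaryKernel
  split_ifs
  · rw [← ENNReal.ofReal_mul (by positivity), ← lintegral_boundaryWeight (by positivity)]
    exact lintegral_sub_left_eq_self
      (fun v => ENNReal.ofReal (boundaryWeight (dist z.1 z.2 / r) v)) (fun l => z.1 l / r)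
  · simp

lemma lintegral_lintegral_boundaryKernel {m : ℕ} {H : Euc m × Euc m → ℝ≥0∞} (hH : Measurable H)
    (hH0 : ∀ z, dist z.1 z.2 = 0 → H z = 0) {r : ℝ} (hr : 0 < r) :
    ∫⁻ c, ∫⁻ z, H z * ENNReal.ofReal (boundaryKernel r c z)
      = ENNReal.ofReal (2 * m * 5 ^ (m - 1) * Real.pi) * ∫⁻ z, H z *
        ENNReal.ofReal (if dist z.1 z.2 < 4 * r then dist z.1 z.2 / r else 0) := by
  have hK := measurable_boundaryKernel (m := m) r
  have hHK := (hH.comp measurable_snd).mul hK.ennreal_ofReal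
  rw [lintegral_lintegral_swap hHK.aemeasurable,
    ← lintegral_const_mul' _ _ ENNReal.ofReal_ne_top]
  refine lintegral_congr fun z => ?_
  have hKz : Measurable fun c : Fin m → ℝ => boundaryKernel r c z :=
    hK.of_uncurry_right
  rw [lintegral_const_mul _ hKz.ennreal_ofReal]
  rcases dist_nonneg.eq_or_lt' (a := dist z.1 z.2) with hd | hd
  · simp [hH0 z hd]
  · rw [lintegral_boundaryKernel hr hd, mul_left_comm]

lemma lintegral_scale_lintegral_le {m : ℕ} {H : Euc m × Euc m → ℝ≥0∞} (hH : Measurable H) :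
    ∫⁻ r in Ioi (0 : ℝ), (∫⁻ z, H z *
        ENNReal.ofReal (if dist z.1 z.2 < 4 * r then dist z.1 z.2 / r else 0)) *
        ENNReal.ofReal r⁻¹
      ≤ ENNReal.ofReal 4 * ∫⁻ z, H z := by
  have hS : Measurable fun q : ℝ × (Euc m × Euc m) => ENNReal.ofReal
      (if dist q.2.1 q.2.2 < 4 * q.1 then dist q.2.1 q.2.2 / q.1 else 0) :=
    (Measurable.ite (measurableSet_lt (by fun_prop) (by fun_prop)) (by fun_prop)
      measurable_const).ennreal_ofReal
  have hinv : Measurable fun q : ℝ × (Euc m × Euc m) => ENNReal.ofReal q.1⁻¹ := by fun_prop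
  have hHS := ((hH.comp measurable_snd).mul hS).mul hinv
  simp_rw [← lintegral_mul_const' _ _ ENNReal.ofReal_ne_top]
  rw [lintegral_lintegral_swap hHS.aemeasurable,
    ← lintegral_const_mul' _ _ ENNReal.ofReal_ne_top]
  refine lintegral_mono fun z => ?_
  simp_rw [mul_assoc]
  rw [lintegral_const_mul _ (by
    exact (hS.comp (measurable_id.prodMk measurable_const)).mul (by fun_prop)), mul_comm]
  gcongr
  exact lintegral_scale_le dist_nonneg

lemma lintegral_tsum_iSup_le {m : ℕ} {S : (Fin m → ℝ) → Set (Euc m)} {T : Set ℝ}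
    {M : Euc m → ℝ → ℝ≥0∞} {G : (Fin m → ℝ) → ℝ≥0∞} (hG : Measurable G)
    (hle : ∀ c, ∀ x ∈ S c, ∀ t ∈ T, M x t ≤ G c) :
    ∫⁻ h in Icc (0 : Fin m → ℝ) 1, ∑' j : Fin m → ℤ,
      ⨆ x ∈ S (fun i => (j i : ℝ) + h i), ⨆ t ∈ T, M x t ≤ ∫⁻ c, G c := by
  rw [← lintegral_Icc_tsum_translates hG]
  exact lintegral_mono fun h => ENNReal.tsum_le_tsum fun j =>
    iSup₂_le fun x hx => iSup₂_le fun t ht => hle _ x hx t ht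

/-- Proposition 2.2 (transversal estimate). -/
theorem transversal_estimate (m : ℕ) (hm : 1 ≤ m) (p : ℝ) (hp : 1 ≤ p) :
    ∃ C : ℝ, 0 < C ∧
      ∀ (N : Type) [MetricSpace N] [CompactSpace N]
        [MeasurableSpace N] [BorelSpace N],
      ∀ (u : Euc m → N), Measurable u →
      ∀ (lam : ℝ), 2 ≤ lam →
      ∀ (δ : ℝ), 0 ≤ δ →
      (∫⁻ τ in Ioc (1 : ℝ) lam,
        (∑' k : ℤ, ∫⁻ h in Icc (0 : Fin m → ℝ) 1,
          ∑' j : Fin m → ℤ,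
            ⨆ x' ∈ frontier (cube m (τ * lam ^ (-k)) (fun i => (j i : ℝ) + h i)),
              ⨆ t ∈ Icc (τ * lam ^ (-k) / (lam - 1)) (τ * lam ^ (-(k - 1)) / (lam - 1)),
                MO p δ u x' t)
          * ENNReal.ofReal τ⁻¹)
      ≤ ENNReal.ofReal C * truncGagliardo p (δ / 2) u := by
  have hVinv : (volume (ball (0 : Euc m) 1))⁻¹ ≠ ∞ :=
    ENNReal.inv_ne_top.2 (measure_ball_pos volume _ one_pos).ne'
  set K : ℝ≥0∞ := (volume (ball (0 : Euc m) 1))⁻¹ * (volume (ball (0 : Euc m) 1))⁻¹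
    * ENNReal.ofReal (4 ^ m * (5 / 4))
  set W : ℝ≥0∞ := ENNReal.ofReal (2 * m * 5 ^ (m - 1) * Real.pi)
  have hK : K ≠ ∞ := ENNReal.mul_ne_top (ENNReal.mul_ne_top hVinv hVinv) ENNReal.ofReal_ne_top
  have hKW : K * W ≠ ∞ := ENNReal.mul_ne_top hK ENNReal.ofReal_ne_top
  have hC : K * W * ENNReal.ofReal 4 ≠ ∞ := ENNReal.mul_ne_top hKW ENNReal.ofReal_ne_top
  refine ⟨(K * W * ENNReal.ofReal 4).toReal + 1, by positivity, ?_⟩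
  intro N _ _ _ _ u hu lam hlam δ hδ
  set H := gagliardoDensity p (δ / 2) u
  have hH : Measurable H := measurable_gagliardoDensity p (δ / 2) hu
  set F : ℝ → ℝ≥0∞ := fun r => ∫⁻ z, H z *
    ENNReal.ofReal (if dist z.1 z.2 < 4 * r then dist z.1 z.2 / r else 0)
  have hF : Measurable F := by
    refine Measurable.lintegral_prod_right' (f := fun q : ℝ × (Euc m × Euc m) => H q.2 *
      ENNReal.ofReal (if dist q.2.1 q.2.2 < 4 * q.1 then dist q.2.1 q.2.2 / q.1 else 0)) ?_
    exact (hH.comp measurable_snd).mul (Measurable.ite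
      (measurableSet_lt (by fun_prop) (by fun_prop)) (by fun_prop) measurable_const).ennreal_ofReal
  have hscale (r : ℝ) (hr : 0 < r) (T : Set ℝ) (hT : ∀ t ∈ T, 0 < t ∧ t ≤ 2 * r) :
      ∫⁻ h in Icc (0 : Fin m → ℝ) 1, ∑' j : Fin m → ℤ,
        ⨆ x' ∈ frontier (cube m r (fun i => (j i : ℝ) + h i)), ⨆ t ∈ T, MO p δ u x' t
      ≤ K * W * F r := by
    have hHK := (hH.comp measurable_snd).mul (measurable_boundaryKernel (m := m) r).ennreal_ofReal
    have hinner : Measurable fun c : Fin m → ℝ =>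
        ∫⁻ z, H z * ENNReal.ofReal (boundaryKernel r c z) := hHK.lintegral_prod_right'
    have hle : ∀ c : Fin m → ℝ, ∀ x' ∈ frontier (cube m r c), ∀ t ∈ T, MO p δ u x' t
        ≤ K * ∫⁻ z, H z * ENNReal.ofReal (boundaryKernel r c z) := fun c x' hx' t ht =>
      MO_le_lintegral_boundaryKernel hm (by linarith) (by linarith) (by linarith) hu hr
        (hT t ht).1 (hT t ht).2 hx'
    refine (lintegral_tsum_iSup_le (hinner.const_mul K) hle).trans_eq ?_
    rw [lintegral_const_mul _ hinner, lintegral_lintegral_boundaryKernel hH (fun z hz =>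
      gagliardoDensity_of_dist_eq_zero (by linarith) (by linarith) u hz) hr]
    exact (mul_assoc K W (F r)).symm
  calc _ ≤ ∫⁻ τ in Ioc (1 : ℝ) lam,
        (∑' k : ℤ, K * W * F (τ * lam ^ (-k))) * ENNReal.ofReal τ⁻¹ := by
        refine setLIntegral_mono' measurableSet_Ioc fun τ hτ => ?_
        gcongr with k
        have hr : 0 < τ * lam ^ (-k) :=
          mul_pos (by linarith [hτ.1]) (zpow_pos (by linarith) _)
        refine hscale _ hr _ fun t ht => ⟨(div_pos hr (by linarith)).trans_le ht.1, ?_⟩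
        refine ht.2.trans ?_
        rw [show -(k - 1) = -k + 1 by ring, zpow_add_one₀ (by linarith), ← mul_assoc,
          div_le_iff₀ (by linarith)]
        nlinarith
    _ ≤ ∫⁻ r in Ioi (0 : ℝ), K * W * F r * ENNReal.ofReal r⁻¹ :=
        lintegral_tsum_zpow_le (by linarith) (hF.const_mul _)
    _ ≤ K * W * (ENNReal.ofReal 4 * ∫⁻ z, H z) := by
        simp_rw [mul_assoc (K * W)]
        rw [lintegral_const_mul' _ _ hKW]
        gcongr
        exact lintegral_scale_lintegral_le hH
    _ = K * W * ENNReal.ofReal 4 * truncGagliardo p (δ / 2) u := by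
        rw [lintegral_gagliardoDensity p (δ / 2) hu, ← mul_assoc (K * W)]
    _ ≤ _ := by
        gcongr
        exact (ENNReal.ofReal_toReal hC).symm.le.trans (ENNReal.ofReal_le_ofReal (by linarith))
end
end

section
/- For every integer m ≥ 1 and every p ∈ [1,∞) there exists a constant C = C(m,p) ∈ (0,∞) such that for every compact metric space (N,d), every Borel measurable map u : ℝ^m → N, every λ ∈ [2,∞) and every δ ∈ [0,∞), one has ∫_1^λ Σ_{k∈ℤ} ∫_{[0,1]^m} Σ_{j∈ℤ^m} sup{ MO_{δ,p}u(x) : x ∈ ∂Q^+_{λ,τ,k,h,j} } dh (dτ/τ) ≤ C · ∬_{ℝ^m×ℝ^m} (d(u(y),u(z)) − δ/2)_+^p / |y−z|^{2m} dy dz, where ∂Q^+_{λ,τ,k,h,j} is the topological boundary in ℝ^{m+1} of the λ-adic cube Q^+_{λ,τ,k,h,j}. -/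
open MeasureTheory Metric Set
open scoped ENNReal Topology

noncomputable section

/-- The λ-adic cube `Q⁺_{λ,τ,k,h,j}` of the half-space `ℝ^m × (0,∞)`, with base
`τλ^{-k}([0,1]^m + c)` (where `c = j + h`) and height interval
`[τλ^{-k}/(λ-1), τλ^{-(k-1)}/(λ-1)]`. -/
def cubeQ (m : ℕ) (lam τ : ℝ) (k : ℤ) (c : Fin m → ℝ) : Set (Euc m × ℝ) :=
  cube m (τ * lam ^ (-k)) c ×ˢ
    Icc (τ * lam ^ (-k) / (lam - 1)) (τ * lam ^ (-(k - 1)) / (lam - 1))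

/-- Periodization: integrating over the unit cube the sum over integer translates gives at most
the full integral. -/
lemma lintegral_Icc_tsum_int_translate_le {m : ℕ} {g : (Fin m → ℝ) → ℝ≥0∞} (hg : Measurable g) :
    ∫⁻ h in Icc (0 : Fin m → ℝ) 1, ∑' j : Fin m → ℤ, g (fun i => (j i : ℝ) + h i) ≤
      ∫⁻ c, g c := by
  set T : (Fin m → ℤ) → Set (Fin m → ℝ) := fun j => {c | ∀ i, ⌊c i⌋ = j i} with hT
  have hTm : ∀ j, MeasurableSet (T j) := fun j => by
    have : T j = ⋂ i, (fun c : Fin m → ℝ => ⌊c i⌋) ⁻¹' {j i} := by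
      ext c; simp [hT]
    rw [this]
    exact MeasurableSet.iInter fun i =>
      (Int.measurable_floor.comp (measurable_pi_apply i)) (measurableSet_singleton _)
  have hae : (Icc (0 : Fin m → ℝ) 1 : Set (Fin m → ℝ)) =ᵐ[volume]
      (univ.pi fun i : Fin m => Ico (0 : ℝ) 1 : Set (Fin m → ℝ)) :=
    (Measure.univ_pi_Ico_ae_eq_Icc (μ := fun _ : Fin m => (volume : Measure ℝ))
      (f := 0) (g := 1)).symm
  have hshift : ∀ j : Fin m → ℤ, Measurable fun h : Fin m → ℝ => fun i => (j i : ℝ) + h i :=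
    fun j => by fun_prop
  calc ∫⁻ h in Icc (0 : Fin m → ℝ) 1, ∑' j : Fin m → ℤ, g (fun i => (j i : ℝ) + h i)
      = ∫⁻ h in (univ.pi fun i : Fin m => Ico (0 : ℝ) 1),
          ∑' j : Fin m → ℤ, g (fun i => (j i : ℝ) + h i) := setLIntegral_congr hae
    _ = ∑' j : Fin m → ℤ, ∫⁻ h in (univ.pi fun i : Fin m => Ico (0 : ℝ) 1),
          g (fun i => (j i : ℝ) + h i) :=
        lintegral_tsum fun j => (hg.comp (hshift j)).aemeasurable
    _ = ∑' j : Fin m → ℤ, ∫⁻ c in T j, g c := by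
        refine tsum_congr fun j => ?_
        rw [← lintegral_indicator (hTm j),
          ← lintegral_indicator (MeasurableSet.univ_pi fun _ => measurableSet_Ico),
          ← lintegral_add_left_eq_self ((T j).indicator g) (fun i => (j i : ℝ))]
        refine lintegral_congr fun h => ?_
        have : h ∈ (univ.pi fun i : Fin m => Ico (0 : ℝ) 1) ↔ (fun i => (j i : ℝ)) + h ∈ T j := by
          simp only [hT, mem_pi, mem_univ, true_implies, mem_ofPred_eq, Pi.add_apply,
            Int.floor_intCast_add]
          refine forall_congr' fun i => ?_
          rw [mem_Ico, add_eq_left, Int.floor_eq_zero_iff, mem_Ico]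
        by_cases hh : h ∈ (univ.pi fun i : Fin m => Ico (0 : ℝ) 1)
        · rw [indicator_of_mem hh, indicator_of_mem (this.1 hh)]; rfl
        · rw [indicator_of_notMem hh, indicator_of_notMem (fun h' => hh (this.2 h'))]
    _ = ∫⁻ c in ⋃ j, T j, g c := by
        refine (lintegral_iUnion hTm ?_ g).symm
        intro j j' hjj
        refine Set.disjoint_left.2 fun c hc hc' => hjj ?_
        funext i
        exact (hc i).symm.trans (hc' i)
    _ ≤ ∫⁻ c, g c := setLIntegral_le_lintegral _ _

/-- Logarithmic unfolding: the multiplicative translates of `(1, lam]` by powers of `lam` are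
disjoint in `(0, ∞)`. -/
lemma lintegral_Ioc_tsum_zpow_le {lam : ℝ} (hlam : 1 < lam) {F : ℝ → ℝ≥0∞} (hF : Measurable F) :
    ∫⁻ τ in Ioc (1 : ℝ) lam, (∑' k : ℤ, F (τ * lam ^ (-k))) * ENNReal.ofReal τ⁻¹ ≤
      ∫⁻ s in Ioi (0 : ℝ), F s * ENNReal.ofReal s⁻¹ := by
  have h0 : 0 < lam := by linarith
  set S : ℤ → Set ℝ := fun k => (fun τ => τ * lam ^ (-k)) '' Ioc (1 : ℝ) lam with hS
  have hSeq : ∀ k, S k = Ioc (lam ^ (-k)) (lam ^ (-k + 1)) := fun k => by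
    have := image_mul_right_Ioc (1 : ℝ) lam (zpow_pos h0 (-k))
    simp only [hS]
    rw [this, one_mul, zpow_add₀ h0.ne', zpow_one, mul_comm]
  calc ∫⁻ τ in Ioc (1 : ℝ) lam, (∑' k : ℤ, F (τ * lam ^ (-k))) * ENNReal.ofReal τ⁻¹
      = ∑' k : ℤ, ∫⁻ τ in Ioc (1 : ℝ) lam, F (τ * lam ^ (-k)) * ENNReal.ofReal τ⁻¹ := by
        simp_rw [← ENNReal.tsum_mul_right]
        exact lintegral_tsum fun k => by fun_prop
    _ = ∑' k : ℤ, ∫⁻ s in S k, F s * ENNReal.ofReal s⁻¹ := by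
        refine tsum_congr fun k => ?_
        have hk : 0 < lam ^ (-k) := zpow_pos h0 _
        rw [hS, lintegral_image_eq_lintegral_abs_deriv_mul (f' := fun _ => lam ^ (-k))
          measurableSet_Ioc
          (fun x _ => by simpa using ((hasDerivAt_id x).mul_const (lam ^ (-k))).hasDerivWithinAt)
          (fun x _ y _ h => mul_right_cancel₀ hk.ne' h)]
        refine setLIntegral_congr_fun measurableSet_Ioc fun τ hτ => ?_
        have hτ0 : 0 < τ := by linarith [hτ.1]
        rw [mul_left_comm, ← ENNReal.ofReal_mul (abs_nonneg _), abs_of_pos hk, mul_inv,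
          mul_left_comm, mul_inv_cancel₀ hk.ne', mul_one]
    _ = ∫⁻ s in ⋃ k, S k, F s * ENNReal.ofReal s⁻¹ := by
        refine (lintegral_iUnion (fun k => by rw [hSeq]; exact measurableSet_Ioc) ?_ _).symm
        intro k k' hkk
        have aux : ∀ a b : ℤ, a < b → Disjoint (S a) (S b) := fun a b hab => by
          rw [hSeq, hSeq]
          refine Set.disjoint_left.2 fun s hs hs' => ?_
          have : lam ^ (-b + 1) ≤ lam ^ (-a) := zpow_le_zpow_right₀ hlam.le (by lia)
          linarith [hs.1, hs'.2]
        rcases lt_or_gt_of_ne hkk with h | h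
        · exact aux _ _ h
        · exact (aux _ _ h).symm
    _ ≤ ∫⁻ s in Ioi (0 : ℝ), F s * ENNReal.ofReal s⁻¹ := by
        refine lintegral_mono_set (iUnion_subset fun k => ?_)
        rw [hSeq]
        exact fun s hs => (zpow_pos h0 _).trans hs.1

/-- An elementary tail integral. -/
lemma lintegral_Ioi_rpow_neg_le {a : ℝ} (ha : 0 < a) {n : ℕ} (hn : 1 ≤ n) :
    ∫⁻ s in Ioi a, ENNReal.ofReal ((s ^ (n + 1))⁻¹) ≤ ENNReal.ofReal ((a ^ n)⁻¹) := by
  have hn' : (1 : ℝ) ≤ n := by exact_mod_cast hn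
  have hlt : -((n : ℝ) + 1) < -1 := by linarith
  have hcongr : ∀ s ∈ Ioi a, ENNReal.ofReal ((s ^ (n + 1))⁻¹) =
      ENNReal.ofReal (s ^ (-((n : ℝ) + 1))) := fun s hs => by
    have hs0 : 0 < s := ha.trans hs
    rw [Real.rpow_neg hs0.le, ← Nat.cast_add_one, Real.rpow_natCast]
  rw [setLIntegral_congr_fun measurableSet_Ioi hcongr,
    ← ofReal_integral_eq_lintegral_ofReal (integrableOn_Ioi_rpow_of_lt hlt ha)
      ((ae_restrict_iff' measurableSet_Ioi).2 (Filter.Eventually.of_forall fun s hs =>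
        Real.rpow_nonneg (ha.trans hs).le _)), integral_Ioi_rpow_of_lt hlt ha]
  refine ENNReal.ofReal_le_ofReal ?_
  have h1 : -((n : ℝ) + 1) + 1 = -(n : ℝ) := by ring
  rw [h1, Real.rpow_neg ha.le, Real.rpow_natCast, neg_div_neg_eq]
  exact div_le_self (by positivity) hn'

/-- A dyadic interval has logarithmic length at most one. -/
lemma lintegral_Icc_half_inv_le {a : ℝ} (ha : 0 < a) :
    ∫⁻ s in Icc (a / 2) a, ENNReal.ofReal s⁻¹ ≤ 1 := by
  calc ∫⁻ s in Icc (a / 2) a, ENNReal.ofReal s⁻¹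
      ≤ ∫⁻ _ in Icc (a / 2) a, ENNReal.ofReal (a / 2)⁻¹ := by
        refine setLIntegral_mono measurable_const fun s hs => ENNReal.ofReal_le_ofReal ?_
        exact inv_anti₀ (by positivity) hs.1
    _ = 1 := by
        rw [setLIntegral_const, Real.volume_Icc, ← ENNReal.ofReal_mul (by positivity),
          ← ENNReal.ofReal_one]
        congr 1
        field_simp
        ring

lemma isClosed_cube {m : ℕ} (r : ℝ) (c : Fin m → ℝ) : IsClosed (cube m r c) := by
  have : cube m r c = ⋂ i, (fun x : Euc m => x i) ⁻¹' Icc (r * c i) (r * (c i + 1)) := by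
    ext; simp [cube]
  rw [this]
  exact isClosed_iInter fun i => isClosed_Icc.preimage (by fun_prop)

lemma mem_cube_of_mem_frontier_cube {m : ℕ} {r : ℝ} {c : Fin m → ℝ} {x : Euc m}
    (hx : x ∈ frontier (cube m r c)) :
    x ∈ cube m r c ∧ ∃ i, x i = r * c i ∨ x i = r * (c i + 1) := by
  have hcoord : ∀ i : Fin m, Continuous fun x : Euc m => x i := fun i => by fun_prop
  have hmem : x ∈ cube m r c := (isClosed_cube r c).frontier_subset hx
  refine ⟨hmem, ?_⟩
  by_contra! hne
  have hopen : IsOpen (⋂ i, (fun x : Euc m => x i) ⁻¹' Ioo (r * c i) (r * (c i + 1))) :=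
    isOpen_iInter_of_finite fun i => isOpen_Ioo.preimage (hcoord i)
  refine hx.2 (interior_maximal (fun y hy i => ?_) hopen (mem_iInter.2 fun i => ?_))
  · exact Ioo_subset_Icc_self (mem_iInter.1 hy i)
  · exact ⟨(hmem i).1.lt_of_ne (hne i).1.symm, (hmem i).2.lt_of_ne (hne i).2⟩

/-- Pairs `((ρ, w), (s, c))` for which `(w, ρ)` is close to the boundary of the cube with edge
length `s` and position `c`, at the scale `ρ`. -/
def nearBoundary (m : ℕ) (lam : ℝ) : Set ((ℝ × Euc m) × (ℝ × (Fin m → ℝ))) :=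
  {q | (∀ i, q.1.2 i / q.2.1 - q.2.2 i ∈ Icc (-4 : ℝ) 5) ∧
    (q.2.1 ∈ Icc ((lam - 1) * q.1.1 / 2) ((lam - 1) * q.1.1) ∨
      q.2.1 ∈ Icc ((lam - 1) / lam * q.1.1 / 2) ((lam - 1) / lam * q.1.1) ∨
      (q.1.1 / 4 ≤ q.2.1 ∧ ∃ i, |q.1.2 i / q.2.1 - q.2.2 i| ≤ q.1.1 / q.2.1 ∨
        |q.1.2 i / q.2.1 - q.2.2 i - 1| ≤ q.1.1 / q.2.1))}

lemma measurableSet_nearBoundary (m : ℕ) (lam : ℝ) : MeasurableSet (nearBoundary m lam) := by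
  have hv : ∀ i : Fin m, Measurable fun q : (ℝ × Euc m) × (ℝ × (Fin m → ℝ)) =>
      q.1.2 i / q.2.1 - q.2.2 i := fun i => by fun_prop
  have habs : Measurable fun t : ℝ => |t| := continuous_abs.measurable
  have hr : Measurable fun q : (ℝ × Euc m) × (ℝ × (Fin m → ℝ)) => q.1.1 / q.2.1 := by fun_prop
  have hs : Measurable fun q : (ℝ × Euc m) × (ℝ × (Fin m → ℝ)) => q.2.1 := by fun_prop
  have hIcc : ∀ b : ℝ, MeasurableSet {q : (ℝ × Euc m) × (ℝ × (Fin m → ℝ)) |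
      q.2.1 ∈ Icc (b * q.1.1 / 2) (b * q.1.1)} := fun b =>
    (measurableSet_le (by fun_prop) hs).inter (measurableSet_le hs (by fun_prop))
  have hbox : MeasurableSet {q : (ℝ × Euc m) × (ℝ × (Fin m → ℝ)) |
      ∀ i, q.1.2 i / q.2.1 - q.2.2 i ∈ Icc (-4 : ℝ) 5} :=
    measurableSet_setOfPred.2 <| Measurable.forall fun i =>
      measurableSet_setOfPred.1 <| (hv i) measurableSet_Icc
  have hface : MeasurableSet {q : (ℝ × Euc m) × (ℝ × (Fin m → ℝ)) |
      ∃ i, |q.1.2 i / q.2.1 - q.2.2 i| ≤ q.1.1 / q.2.1 ∨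
        |q.1.2 i / q.2.1 - q.2.2 i - 1| ≤ q.1.1 / q.2.1} :=
    measurableSet_setOfPred.2 <| Measurable.exists fun i => measurableSet_setOfPred.1 <|
      (measurableSet_le (habs.comp (hv i)) hr).union
        (measurableSet_le (habs.comp ((hv i).sub_const 1)) hr)
  exact hbox.inter ((hIcc (lam - 1)).union ((hIcc ((lam - 1) / lam)).union
    ((measurableSet_le (by fun_prop) hs).inter hface)))

lemma mem_nearBoundary_of_mem_frontier {m : ℕ} {lam : ℝ} (hlam : 2 ≤ lam) {τ : ℝ} {k : ℤ}
    (hτ : 0 < τ) {c : Fin m → ℝ} {x : Euc m × ℝ} (hx : x ∈ frontier (cubeQ m lam τ k c))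
    {ρ : ℝ} (hρ : ρ ∈ Icc x.2 (2 * x.2)) {w : Euc m} (hw : w ∈ ball x.1 x.2) :
    ((ρ, w), (τ * lam ^ (-k), c)) ∈ nearBoundary m lam := by
  have h0 : 0 < lam := by linarith
  have h1 : 0 < lam - 1 := by linarith
  set s := τ * lam ^ (-k) with hs
  have hs0 : 0 < s := mul_pos hτ (zpow_pos h0 _)
  have htop : τ * lam ^ (-(k - 1)) / (lam - 1) = s * lam / (lam - 1) := by
    rw [hs, neg_sub, sub_eq_neg_add, zpow_add₀ h0.ne', zpow_one, mul_assoc]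
  obtain ⟨ξ, r⟩ := x
  simp only at hρ hw
  have hQ : cubeQ m lam τ k c = cube m s c ×ˢ Icc (s / (lam - 1)) (s * lam / (lam - 1)) := by
    rw [cubeQ, htop]
  have hle : s / (lam - 1) ≤ s * lam / (lam - 1) := by
    gcongr
    nlinarith
  rw [hQ, frontier_prod_eq, frontier_Icc hle, isClosed_Icc.closure_eq,
    (isClosed_cube s c).closure_eq] at hx
  have hξ : ξ ∈ cube m s c := by
    rcases hx with hx | hx
    · exact hx.1
    · exact (mem_cube_of_mem_frontier_cube hx.1).1
  have hr : r ∈ Icc (s / (lam - 1)) (s * lam / (lam - 1)) := by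
    rcases hx with hx | hx
    · exact insert_subset_iff.2 ⟨left_mem_Icc.2 hle, singleton_subset_iff.2 (right_mem_Icc.2 hle)⟩
        hx.2
    · exact hx.2
  have hr2 : r ≤ 2 * s := by
    refine hr.2.trans ?_
    rw [div_le_iff₀ h1]
    nlinarith
  have hρ4 : ρ / s ≤ 4 := by
    rw [div_le_iff₀ hs0]
    linarith [hρ.2]
  have hdist : ∀ i, |w i / s - ξ i / s| ≤ ρ / s := fun i => by
    rw [← sub_div, abs_div, abs_of_pos hs0]
    gcongr
    have h := PiLp.norm_apply_le (w - ξ) i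
    rw [← dist_eq_norm, PiLp.sub_apply, Real.norm_eq_abs] at h
    exact h.trans ((mem_ball.1 hw).le.trans hρ.1)
  have hc : ∀ i, ξ i / s - c i ∈ Icc (0 : ℝ) 1 := fun i => by
    have := hξ i
    constructor
    · rw [sub_nonneg, le_div_iff₀ hs0]; linarith [this.1]
    · rw [sub_le_iff_le_add, div_le_iff₀ hs0]; linarith [this.2]
  refine ⟨fun i => ?_, ?_⟩
  · have h1 := abs_le.1 (hdist i)
    have h2 := hc i
    simp only [mem_Icc] at h2 ⊢
    constructor <;> linarith
  · rcases hx with hx | hx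
    · have hr' : r = s / (lam - 1) ∨ r = s * lam / (lam - 1) := hx.2
      rcases hr' with h | h
      · left
        have h : s = (lam - 1) * r := by rw [h]; field_simp
        simp only [mem_Icc]
        constructor <;> nlinarith [hρ.1, hρ.2]
      · right; left
        have h : s = (lam - 1) / lam * r := by rw [h]; field_simp
        have hpos : 0 < (lam - 1) / lam := by positivity
        simp only [mem_Icc]
        constructor <;> nlinarith [hρ.1, hρ.2]
    · right; right
      obtain ⟨-, i, hi⟩ := mem_cube_of_mem_frontier_cube hx.1
      refine ⟨by simp only; linarith [hρ.2], i, ?_⟩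
      have h1 := hdist i
      rcases hi with hi | hi
      · left
        rwa [hi, mul_div_cancel_left₀ _ hs0.ne'] at h1
      · right
        rwa [hi, mul_div_cancel_left₀ _ hs0.ne', ← sub_sub] at h1

lemma volume_slab_le {m : ℕ} (a : Fin m → ℝ) (b t : ℝ) (i : Fin m) :
    volume {c : Fin m → ℝ | (∀ l, a l - c l ∈ Icc (-4 : ℝ) 5) ∧ |b - c i| ≤ t} ≤
      ENNReal.ofReal (2 * t) * 9 ^ m := by
  classical
  calc volume {c : Fin m → ℝ | (∀ l, a l - c l ∈ Icc (-4 : ℝ) 5) ∧ |b - c i| ≤ t}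
      ≤ volume (Icc (Function.update (fun l => a l - 5) i (b - t))
          (Function.update (fun l => a l + 4) i (b + t))) := by
        refine measure_mono ?_
        rintro c ⟨hc, hi⟩
        have hi := abs_le.1 hi
        refine ⟨fun l => ?_, fun l => ?_⟩ <;>
        · have hl := hc l
          rcases eq_or_ne l i with rfl | hne
          · rw [Function.update_self]
            linarith [hi.1, hi.2]
          · rw [Function.update_of_ne hne]
            linarith [hl.1, hl.2]
    _ = ∏ l, Function.update (fun _ => (9 : ℝ≥0∞)) i (ENNReal.ofReal (2 * t)) l := by
        rw [Real.volume_Icc_pi]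
        refine Finset.prod_congr rfl fun l _ => ?_
        rcases eq_or_ne l i with rfl | hne
        · simp only [Function.update_self]
          congr 1
          ring
        · simp only [Function.update_of_ne hne]
          rw [show a l + 4 - (a l - 5) = 9 by ring]
          norm_num
    _ ≤ ENNReal.ofReal (2 * t) * 9 ^ m := by
        rw [Finset.prod_update_of_mem (Finset.mem_univ i), Finset.prod_const]
        gcongr
        · norm_num
        · exact (Finset.card_le_univ _).trans (Fintype.card_fin m).le

lemma volume_box_le {m : ℕ} (a : Fin m → ℝ) :
    volume {c : Fin m → ℝ | ∀ l, a l - c l ∈ Icc (-4 : ℝ) 5} ≤ 9 ^ m := by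
  calc volume {c : Fin m → ℝ | ∀ l, a l - c l ∈ Icc (-4 : ℝ) 5}
      ≤ volume (Icc (fun l => a l - 5) (fun l => a l + 4)) := by
        refine measure_mono fun c hc => ⟨fun l => ?_, fun l => ?_⟩ <;>
        · have hl := hc l
          linarith [hl.1, hl.2]
    _ = 9 ^ m := by
        rw [Real.volume_Icc_pi]
        have h9 : ∀ l, ENNReal.ofReal (a l + 4 - (a l - 5)) = 9 := fun l => by
          rw [show a l + 4 - (a l - 5) = 9 by ring]
          norm_num
        simp_rw [h9, Finset.prod_const, Finset.card_univ, Fintype.card_fin]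

lemma volume_nearBoundary_fiber_le {m : ℕ} (lam : ℝ) {ρ s : ℝ} (w : Euc m) :
    volume {c : Fin m → ℝ | ((ρ, w), (s, c)) ∈ nearBoundary m lam} ≤
      (Icc ((lam - 1) * ρ / 2) ((lam - 1) * ρ)).indicator (fun _ => 9 ^ m) s +
      ((Icc ((lam - 1) / lam * ρ / 2) ((lam - 1) / lam * ρ)).indicator (fun _ => 9 ^ m) s +
      (Ici (ρ / 4)).indicator
        (fun s => (m : ℝ≥0∞) * (2 * (ENNReal.ofReal (2 * (ρ / s)) * 9 ^ m))) s) := by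
  set B1 := Icc ((lam - 1) * ρ / 2) ((lam - 1) * ρ)
  set B2 := Icc ((lam - 1) / lam * ρ / 2) ((lam - 1) / lam * ρ)
  set box := {c : Fin m → ℝ | ∀ l, w l / s - c l ∈ Icc (-4 : ℝ) 5}
  have hsub : {c : Fin m → ℝ | ((ρ, w), (s, c)) ∈ nearBoundary m lam} ⊆
      {c | c ∈ box ∧ s ∈ B1} ∪ ({c | c ∈ box ∧ s ∈ B2} ∪
        {c | ρ / 4 ≤ s ∧ c ∈ ⋃ i, ({c | c ∈ box ∧ |w i / s - c i| ≤ ρ / s} ∪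
          {c | c ∈ box ∧ |(w i / s - 1) - c i| ≤ ρ / s})}) := by
    rintro c ⟨hc, h | h | ⟨h, i, hi⟩⟩
    · exact Or.inl ⟨hc, h⟩
    · exact Or.inr (Or.inl ⟨hc, h⟩)
    · refine Or.inr (Or.inr ⟨h, mem_iUnion.2 ⟨i, ?_⟩⟩)
      rcases hi with hi | hi
      · exact Or.inl ⟨hc, hi⟩
      · refine Or.inr ⟨hc, ?_⟩
        rwa [sub_right_comm]
  refine (measure_mono hsub).trans ((measure_union_le _ _).trans (add_le_add ?_
    ((measure_union_le _ _).trans (add_le_add ?_ ?_))))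
  · by_cases h : s ∈ B1
    · rw [indicator_of_mem h]
      exact (measure_mono fun c hc => hc.1).trans (volume_box_le fun l => w l / s)
    · simp [h]
  · by_cases h : s ∈ B2
    · rw [indicator_of_mem h]
      exact (measure_mono fun c hc => hc.1).trans (volume_box_le fun l => w l / s)
    · simp [h]
  · by_cases h : ρ / 4 ≤ s
    · rw [indicator_of_mem (mem_Ici.2 h)]
      have hset : {c | ρ / 4 ≤ s ∧ c ∈ ⋃ i, ({c | c ∈ box ∧ |w i / s - c i| ≤ ρ / s} ∪
          {c | c ∈ box ∧ |(w i / s - 1) - c i| ≤ ρ / s})} ⊆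
          ⋃ i, ({c | c ∈ box ∧ |w i / s - c i| ≤ ρ / s} ∪
          {c | c ∈ box ∧ |(w i / s - 1) - c i| ≤ ρ / s}) := fun c hc => hc.2
      refine (measure_mono hset).trans ((measure_iUnion_fintype_le _ _).trans ?_)
      refine (Finset.sum_le_card_nsmul _ _ _ fun i _ => (measure_union_le _ _).trans
        (add_le_add (volume_slab_le _ _ _ i) (volume_slab_le _ _ _ i))).trans ?_
      rw [Finset.card_univ, Fintype.card_fin, nsmul_eq_mul, ← two_mul (ENNReal.ofReal _ * _)]
    · have hempty : {c | ρ / 4 ≤ s ∧ c ∈ ⋃ i, ({c | c ∈ box ∧ |w i / s - c i| ≤ ρ / s} ∪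
          {c | c ∈ box ∧ |(w i / s - 1) - c i| ≤ ρ / s})} = ∅ :=
        eq_empty_of_forall_notMem fun c hc => h hc.1
      rw [hempty, measure_empty]
      exact zero_le

/-- Averaged over positions and logarithmic scales, a point of the half-space is close to boundaries
of cubes at most a bounded amount of the time. -/
lemma lintegral_nearBoundary_le {m : ℕ} {lam : ℝ} (hlam : 1 < lam) {ρ : ℝ} (hρ : 0 < ρ)
    (w : Euc m) :
    ∫⁻ s in Ioi (0 : ℝ), volume {c : Fin m → ℝ | ((ρ, w), (s, c)) ∈ nearBoundary m lam} *
      ENNReal.ofReal s⁻¹ ≤ ENNReal.ofReal ((2 + 16 * m) * 9 ^ m) := by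
  have h1 : 0 < lam - 1 := by linarith
  have h2 : 0 < (lam - 1) / lam := div_pos h1 (by linarith)
  have hmeas : ∀ b : ℝ, Measurable fun s : ℝ =>
      (Icc (b * ρ / 2) (b * ρ)).indicator (fun _ => (9 : ℝ≥0∞) ^ m) s * ENNReal.ofReal s⁻¹ :=
    fun b => (measurable_const.indicator measurableSet_Icc).mul (by fun_prop)
  have hdyadic : ∀ b : ℝ, 0 < b → ∫⁻ s in Ioi (0 : ℝ),
      (Icc (b * ρ / 2) (b * ρ)).indicator (fun _ => (9 : ℝ≥0∞) ^ m) s * ENNReal.ofReal s⁻¹ ≤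
        9 ^ m := fun b hb => by
    calc ∫⁻ s in Ioi (0 : ℝ),
        (Icc (b * ρ / 2) (b * ρ)).indicator (fun _ => (9 : ℝ≥0∞) ^ m) s * ENNReal.ofReal s⁻¹
        ≤ ∫⁻ s, (Icc (b * ρ / 2) (b * ρ)).indicator
            (fun s => (9 : ℝ≥0∞) ^ m * ENNReal.ofReal s⁻¹) s := by
          refine (setLIntegral_le_lintegral _ _).trans (lintegral_mono fun s => ?_)
          simp only [indicator, ite_mul, zero_mul, le_refl]
      _ = 9 ^ m * ∫⁻ s in Icc (b * ρ / 2) (b * ρ), ENNReal.ofReal s⁻¹ := by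
          rw [lintegral_indicator measurableSet_Icc, lintegral_const_mul _ (by fun_prop)]
      _ ≤ 9 ^ m * 1 := by
          gcongr
          exact lintegral_Icc_half_inv_le (by positivity)
      _ = 9 ^ m := mul_one _
  have hside : ∫⁻ s in Ioi (0 : ℝ), (Ici (ρ / 4)).indicator
      (fun s => (m : ℝ≥0∞) * (2 * (ENNReal.ofReal (2 * (ρ / s)) * 9 ^ m))) s *
        ENNReal.ofReal s⁻¹ ≤ ENNReal.ofReal (16 * m * 9 ^ m) := by
    calc ∫⁻ s in Ioi (0 : ℝ), (Ici (ρ / 4)).indicator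
          (fun s => (m : ℝ≥0∞) * (2 * (ENNReal.ofReal (2 * (ρ / s)) * 9 ^ m))) s *
            ENNReal.ofReal s⁻¹
        ≤ ∫⁻ s, (Ici (ρ / 4)).indicator
            (fun s => (m : ℝ≥0∞) * (2 * (ENNReal.ofReal (2 * (ρ / s)) * 9 ^ m)) *
              ENNReal.ofReal s⁻¹) s := by
          refine (setLIntegral_le_lintegral _ _).trans (lintegral_mono fun s => ?_)
          simp only [indicator, ite_mul, zero_mul, le_refl]
      _ = ∫⁻ s in Ioi (ρ / 4), (m : ℝ≥0∞) * (2 * (ENNReal.ofReal (2 * (ρ / s)) * 9 ^ m)) *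
              ENNReal.ofReal s⁻¹ := by
          rw [lintegral_indicator measurableSet_Ici]
          exact setLIntegral_congr Ioi_ae_eq_Ici.symm
      _ = ∫⁻ s in Ioi (ρ / 4), ENNReal.ofReal (4 * m * 9 ^ m * ρ) *
            ENNReal.ofReal ((s ^ (1 + 1))⁻¹) := by
          refine setLIntegral_congr_fun measurableSet_Ioi fun s hs => ?_
          have hs0 : 0 < s := (by positivity : 0 < ρ / 4).trans hs
          have e1 : (m : ℝ≥0∞) = ENNReal.ofReal m := (ENNReal.ofReal_natCast m).symm
          have e2 : (2 : ℝ≥0∞) = ENNReal.ofReal 2 := by norm_num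
          have e3 : (9 : ℝ≥0∞) ^ m = ENNReal.ofReal (9 ^ m) := by
            rw [ENNReal.ofReal_pow (by norm_num)]; norm_num
          rw [e1, e2, e3, ← ENNReal.ofReal_mul (by positivity),
            ← ENNReal.ofReal_mul (by positivity), ← ENNReal.ofReal_mul (by positivity),
            ← ENNReal.ofReal_mul (by positivity), ← ENNReal.ofReal_mul (by positivity)]
          congr 1
          field_simp
          ring
      _ ≤ ENNReal.ofReal (4 * m * 9 ^ m * ρ) * ENNReal.ofReal (((ρ / 4) ^ 1)⁻¹) := by
          rw [lintegral_const_mul _ (by fun_prop)]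
          gcongr
          exact lintegral_Ioi_rpow_neg_le (by positivity) le_rfl
      _ = ENNReal.ofReal (16 * m * 9 ^ m) := by
          rw [← ENNReal.ofReal_mul (by positivity)]
          congr 1
          field_simp
          ring
  calc ∫⁻ s in Ioi (0 : ℝ), volume {c : Fin m → ℝ | ((ρ, w), (s, c)) ∈ nearBoundary m lam} *
        ENNReal.ofReal s⁻¹
      ≤ ∫⁻ s in Ioi (0 : ℝ),
        ((Icc ((lam - 1) * ρ / 2) ((lam - 1) * ρ)).indicator (fun _ => (9 : ℝ≥0∞) ^ m) s *
            ENNReal.ofReal s⁻¹ +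
        ((Icc ((lam - 1) / lam * ρ / 2) ((lam - 1) / lam * ρ)).indicator
            (fun _ => (9 : ℝ≥0∞) ^ m) s * ENNReal.ofReal s⁻¹ +
        (Ici (ρ / 4)).indicator
          (fun s => (m : ℝ≥0∞) * (2 * (ENNReal.ofReal (2 * (ρ / s)) * 9 ^ m))) s *
            ENNReal.ofReal s⁻¹)) := by
        refine lintegral_mono fun s => ?_
        rw [← add_mul, ← add_mul]
        gcongr
        exact volume_nearBoundary_fiber_le lam w
    _ ≤ 9 ^ m + (9 ^ m + ENNReal.ofReal (16 * m * 9 ^ m)) := by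
        rw [lintegral_add_left (hmeas _), lintegral_add_left (hmeas _)]
        exact add_le_add (hdyadic _ h1) (add_le_add (hdyadic _ h2) hside)
    _ = ENNReal.ofReal ((2 + 16 * m) * 9 ^ m) := by
        have e3 : (9 : ℝ≥0∞) ^ m = ENNReal.ofReal (9 ^ m) := by
          rw [ENNReal.ofReal_pow (by norm_num)]; norm_num
        rw [e3, ← ENNReal.ofReal_add (by positivity) (by positivity),
          ← ENNReal.ofReal_add (by positivity) (by positivity)]
        congr 1
        ring

/-- The points `((ρ, w), (y, z))` with both `y` and `z` in the ball of radius `2ρ` around `w`. -/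
def bothClose (m : ℕ) : Set ((ℝ × Euc m) × (Euc m × Euc m)) :=
  {q | dist q.2.1 q.1.2 < 2 * q.1.1 ∧ dist q.2.2 q.1.2 < 2 * q.1.1}

lemma measurableSet_bothClose (m : ℕ) : MeasurableSet (bothClose m) := by
  have hρ : Measurable fun q : (ℝ × Euc m) × (Euc m × Euc m) => 2 * q.1.1 := by fun_prop
  have hy : Measurable fun q : (ℝ × Euc m) × (Euc m × Euc m) => dist q.2.1 q.1.2 := by fun_prop
  have hz : Measurable fun q : (ℝ × Euc m) × (Euc m × Euc m) => dist q.2.2 q.1.2 := by fun_prop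
  exact (measurableSet_lt hy hρ).inter (measurableSet_lt hz hρ)

/-- The density on the half-space whose averages control mean oscillations. -/
def oscDensity {m : ℕ} (F : Euc m × Euc m → ℝ≥0∞) (x : ℝ × Euc m) : ℝ≥0∞ :=
  ENNReal.ofReal ((x.1 ^ (3 * m + 1))⁻¹) *
    ∫⁻ z, (bothClose m).indicator (fun q => F q.2) (x, z)

lemma measurable_oscDensity {m : ℕ} {F : Euc m × Euc m → ℝ≥0∞} (hF : Measurable F) :
    Measurable (oscDensity F) :=
  Measurable.mul (by fun_prop) (Measurable.lintegral_prod_right'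
    ((hF.comp measurable_snd).indicator (measurableSet_bothClose m)))

lemma volume_euc_ball {m : ℕ} (x : Euc m) {r : ℝ} (hr : 0 < r) :
    volume (ball x r) = ENNReal.ofReal (r ^ m * (volume (ball (0 : Euc m) 1)).toReal) := by
  rw [Measure.addHaar_ball_of_pos volume x hr, finrank_euclideanSpace_fin,
    ENNReal.ofReal_mul (by positivity), ENNReal.ofReal_toReal measure_ball_lt_top.ne]

lemma volume_unit_ball_toReal_pos (m : ℕ) : 0 < (volume (ball (0 : Euc m) 1)).toReal :=
  ENNReal.toReal_pos (measure_ball_pos volume _ one_pos).ne' measure_ball_lt_top.ne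

/-- A double average over a ball is controlled by the integral of `oscDensity` over a nearby
region of the half-space. -/
lemma average_ball_le_lintegral_oscDensity {m : ℕ} {F : Euc m × Euc m → ℝ≥0∞}
    (hF : Measurable F) (x : Euc m) {r : ℝ} (hr : 0 < r) :
    (volume (ball x r))⁻¹ * (volume (ball x r))⁻¹ *
      ∫⁻ y in ball x r, ∫⁻ z in ball x r, F (y, z) ≤
    ENNReal.ofReal (2 ^ (3 * m + 1) / (volume (ball (0 : Euc m) 1)).toReal ^ 3) *
      ∫⁻ q in Icc r (2 * r) ×ˢ ball x r, oscDensity F q := by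
  set o := (volume (ball (0 : Euc m) 1)).toReal with ho
  have ho0 : 0 < o := volume_unit_ball_toReal_pos m
  set G := ∫⁻ z in ball x r ×ˢ ball x r, F z with hG
  have hGeq : ∫⁻ y in ball x r, ∫⁻ z in ball x r, F (y, z) = G := by
    rw [hG, Measure.volume_eq_prod, ← Measure.prod_restrict, lintegral_prod _ hF.aemeasurable]
  have hlow : ∀ q ∈ Icc r (2 * r) ×ˢ ball x r,
      ENNReal.ofReal (((2 * r) ^ (3 * m + 1))⁻¹) * G ≤ oscDensity F q := by
    rintro ⟨ρ, w⟩ ⟨hρ, hw⟩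
    simp only [mem_Icc] at hρ
    have hρ0 : 0 < ρ := hr.trans_le hρ.1
    refine mul_le_mul' (ENNReal.ofReal_le_ofReal ?_) ?_
    · exact inv_anti₀ (by positivity) (pow_le_pow_left₀ hρ0.le hρ.2 _)
    · rw [hG, ← lintegral_indicator (measurableSet_ball.prod measurableSet_ball)]
      refine lintegral_mono fun z => ?_
      by_cases hz : z ∈ ball x r ×ˢ ball x r
      · have hw' : dist x w < r := mem_ball'.1 hw
        have h1 : dist z.1 x < r := hz.1
        have h2 : dist z.2 x < r := hz.2
        have hmem : ((ρ, w), z) ∈ bothClose m :=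
          ⟨by linarith [dist_triangle z.1 x w, hρ.1], by linarith [dist_triangle z.2 x w, hρ.1]⟩
        rw [indicator_of_mem hz, indicator_of_mem hmem]
      · rw [indicator_of_notMem hz]
        exact zero_le
  calc (volume (ball x r))⁻¹ * (volume (ball x r))⁻¹ *
        ∫⁻ y in ball x r, ∫⁻ z in ball x r, F (y, z)
      = ENNReal.ofReal (2 ^ (3 * m + 1) / o ^ 3) *
        ((ENNReal.ofReal (((2 * r) ^ (3 * m + 1))⁻¹) * G) *
          volume (Icc r (2 * r) ×ˢ ball x r)) := by
        rw [hGeq, Measure.volume_eq_prod, Measure.prod_prod, Real.volume_Icc, volume_euc_ball x hr,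
          ← ho, ← ENNReal.ofReal_inv_of_pos (by positivity), ← ENNReal.ofReal_mul (by positivity),
          ← ENNReal.ofReal_mul (by linarith), mul_right_comm (ENNReal.ofReal _) G, ← mul_assoc,
          ← ENNReal.ofReal_mul (by positivity), ← ENNReal.ofReal_mul (by positivity)]
        congr 2
        field_simp
        ring
    _ = ENNReal.ofReal (2 ^ (3 * m + 1) / o ^ 3) * ∫⁻ _ in Icc r (2 * r) ×ˢ ball x r,
        ENNReal.ofReal (((2 * r) ^ (3 * m + 1))⁻¹) * G := by rw [setLIntegral_const]
    _ ≤ _ := by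
        gcongr 1
        exact setLIntegral_mono' (measurableSet_Icc.prod measurableSet_ball) hlow

/-- The total mass of `oscDensity` is controlled by the energy of `F` with kernel
`|y - z| ^ (-2 m)`. -/
lemma lintegral_oscDensity_le {m : ℕ} (hm : 1 ≤ m) {F : Euc m × Euc m → ℝ≥0∞}
    (hF : Measurable F) (hdiag : ∀ y, F (y, y) = 0) :
    ∫⁻ x in Ioi (0 : ℝ) ×ˢ (univ : Set (Euc m)), oscDensity F x ≤
      ENNReal.ofReal (2 ^ m * (volume (ball (0 : Euc m) 1)).toReal * 4 ^ (2 * m)) *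
        ∫⁻ y, ∫⁻ z, F (y, z) / ENNReal.ofReal (dist y z ^ (2 * m)) := by
  set o := (volume (ball (0 : Euc m) 1)).toReal with ho
  have ho0 : 0 < o := volume_unit_ball_toReal_pos m
  set κ : ℝ≥0∞ := ENNReal.ofReal (2 ^ m * o * 4 ^ (2 * m)) with hκ
  have hind : ∀ z : Euc m × Euc m, Measurable fun x : ℝ × Euc m =>
      (bothClose m).indicator (1 : (ℝ × Euc m) × (Euc m × Euc m) → ℝ≥0∞) (x, z) := fun z =>
    (measurable_one.indicator (measurableSet_bothClose m)).comp (by fun_prop)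
  have hinner : ∀ z : Euc m × Euc m, z.1 ≠ z.2 →
      ∫⁻ x in Ioi (0 : ℝ) ×ˢ (univ : Set (Euc m)), ENNReal.ofReal ((x.1 ^ (3 * m + 1))⁻¹) *
        (bothClose m).indicator 1 (x, z) ≤
      κ * ENNReal.ofReal ((dist z.1 z.2 ^ (2 * m))⁻¹) := by
    rintro ⟨y, z⟩ hne
    have hd : 0 < dist y z := dist_pos.2 hne
    have hmeas : Measurable fun x : ℝ × Euc m => ENNReal.ofReal ((x.1 ^ (3 * m + 1))⁻¹) *
        (bothClose m).indicator 1 (x, (y, z)) :=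
      Measurable.mul (by fun_prop) (hind (y, z))
    have hball : ∀ ρ ∈ Ioi (0 : ℝ), ∫⁻ w : Euc m, ENNReal.ofReal ((ρ ^ (3 * m + 1))⁻¹) *
        (bothClose m).indicator 1 ((ρ, w), (y, z)) ≤
        (Ioi (dist y z / 4)).indicator
          (fun ρ => ENNReal.ofReal (2 ^ m * o) * ENNReal.ofReal ((ρ ^ (2 * m + 1))⁻¹)) ρ := by
      intro ρ hρ
      have hρ0 : 0 < ρ := hρ
      by_cases hρd : dist y z / 4 < ρ
      · rw [indicator_of_mem (mem_Ioi.2 hρd), ← ENNReal.ofReal_mul (by positivity)]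
        calc ∫⁻ w : Euc m, ENNReal.ofReal ((ρ ^ (3 * m + 1))⁻¹) *
              (bothClose m).indicator 1 ((ρ, w), (y, z))
            ≤ ∫⁻ w : Euc m, (ball y (2 * ρ)).indicator
              (fun _ => ENNReal.ofReal ((ρ ^ (3 * m + 1))⁻¹)) w := by
              refine lintegral_mono fun w => ?_
              by_cases hw : ((ρ, w), (y, z)) ∈ bothClose m
              · have : w ∈ ball y (2 * ρ) := mem_ball'.2 hw.1
                rw [indicator_of_mem hw, indicator_of_mem this, Pi.one_apply, mul_one]
              · rw [indicator_of_notMem hw, mul_zero]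
                exact zero_le
          _ = ENNReal.ofReal (2 ^ m * o * (ρ ^ (2 * m + 1))⁻¹) := by
              rw [lintegral_indicator measurableSet_ball, setLIntegral_const,
                volume_euc_ball y (by positivity), ← ENNReal.ofReal_mul (by positivity)]
              congr 1
              rw [← ho]
              field_simp
              ring
      · refine (lintegral_eq_zero_of_ae_eq_zero (Filter.Eventually.of_forall fun w => ?_)).trans_le
          zero_le
        have hw : ((ρ, w), (y, z)) ∉ bothClose m := fun hw => hρd <| by
          have h1 : dist y w < 2 * ρ := hw.1
          have h2 : dist z w < 2 * ρ := hw.2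
          linarith [dist_triangle_right y z w]
        simp [hw]
    calc ∫⁻ x in Ioi (0 : ℝ) ×ˢ (univ : Set (Euc m)), ENNReal.ofReal ((x.1 ^ (3 * m + 1))⁻¹) *
          (bothClose m).indicator 1 (x, (y, z))
        = ∫⁻ ρ in Ioi (0 : ℝ), ∫⁻ w : Euc m, ENNReal.ofReal ((ρ ^ (3 * m + 1))⁻¹) *
            (bothClose m).indicator 1 ((ρ, w), (y, z)) := by
          rw [Measure.volume_eq_prod, ← Measure.prod_restrict, Measure.restrict_univ,
            lintegral_prod _ hmeas.aemeasurable]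
      _ ≤ ∫⁻ ρ, (Ioi (dist y z / 4)).indicator (fun ρ =>
            ENNReal.ofReal (2 ^ m * o) * ENNReal.ofReal ((ρ ^ (2 * m + 1))⁻¹)) ρ :=
          (setLIntegral_mono' measurableSet_Ioi hball).trans (setLIntegral_le_lintegral _ _)
      _ ≤ ENNReal.ofReal (2 ^ m * o) * ENNReal.ofReal (((dist y z / 4) ^ (2 * m))⁻¹) := by
          rw [lintegral_indicator measurableSet_Ioi, lintegral_const_mul _ (by fun_prop)]
          gcongr
          exact lintegral_Ioi_rpow_neg_le (by positivity) (by lia)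
      _ = κ * ENNReal.ofReal ((dist y z ^ (2 * m))⁻¹) := by
          rw [hκ, ← ENNReal.ofReal_mul (by positivity), ← ENNReal.ofReal_mul (by positivity),
            div_pow, inv_div, mul_assoc _ ((4 : ℝ) ^ (2 * m)), div_eq_mul_inv]
  have hmeas1 : Measurable fun q : (ℝ × Euc m) × (Euc m × Euc m) =>
      (bothClose m).indicator (fun q => F q.2) q :=
    (hF.comp measurable_snd).indicator (measurableSet_bothClose m)
  calc ∫⁻ x in Ioi (0 : ℝ) ×ˢ (univ : Set (Euc m)), oscDensity F x
      = ∫⁻ x in Ioi (0 : ℝ) ×ˢ (univ : Set (Euc m)), ∫⁻ z,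
          ENNReal.ofReal ((x.1 ^ (3 * m + 1))⁻¹) *
            (bothClose m).indicator (fun q => F q.2) (x, z) := by
        refine lintegral_congr fun x => ?_
        rw [oscDensity, lintegral_const_mul]
        exact hmeas1.comp (by fun_prop)
    _ = ∫⁻ z, ∫⁻ x in Ioi (0 : ℝ) ×ˢ (univ : Set (Euc m)),
          ENNReal.ofReal ((x.1 ^ (3 * m + 1))⁻¹) *
            (bothClose m).indicator (fun q => F q.2) (x, z) :=
        lintegral_lintegral_swap (Measurable.aemeasurable (Measurable.mul (by fun_prop) hmeas1))
    _ ≤ ∫⁻ z, κ * (F z / ENNReal.ofReal (dist z.1 z.2 ^ (2 * m))) := by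
        refine lintegral_mono fun z => ?_
        calc ∫⁻ x in Ioi (0 : ℝ) ×ˢ (univ : Set (Euc m)),
              ENNReal.ofReal ((x.1 ^ (3 * m + 1))⁻¹) *
                (bothClose m).indicator (fun q => F q.2) (x, z)
            = ∫⁻ x in Ioi (0 : ℝ) ×ˢ (univ : Set (Euc m)), F z *
                (ENNReal.ofReal ((x.1 ^ (3 * m + 1))⁻¹) *
                (bothClose m).indicator 1 (x, z)) := by
              refine lintegral_congr fun x => ?_
              by_cases hx : (x, z) ∈ bothClose m
              · simp only [indicator_of_mem hx, Pi.one_apply, mul_one]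
                rw [mul_comm]
              · simp only [indicator_of_notMem hx, mul_zero]
          _ = F z * ∫⁻ x in Ioi (0 : ℝ) ×ˢ (univ : Set (Euc m)),
                (ENNReal.ofReal ((x.1 ^ (3 * m + 1))⁻¹) *
                (bothClose m).indicator 1 (x, z)) := by
              refine lintegral_const_mul _ (Measurable.mul (by fun_prop) ?_)
              exact hind z
          _ ≤ κ * (F z / ENNReal.ofReal (dist z.1 z.2 ^ (2 * m))) := by
              by_cases hz : z.1 = z.2
              · have : F z = 0 := by
                  obtain ⟨y, z⟩ := z
                  obtain rfl : y = z := hz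
                  exact hdiag y
                simp [this]
              · have hd : 0 < dist z.1 z.2 := dist_pos.2 hz
                rw [div_eq_mul_inv, ← ENNReal.ofReal_inv_of_pos (by positivity), mul_left_comm]
                gcongr
                exact hinner z hz
    _ = κ * ∫⁻ y, ∫⁻ z, F (y, z) / ENNReal.ofReal (dist y z ^ (2 * m)) := by
        have hmeas2 : Measurable fun z : Euc m × Euc m =>
            F z / ENNReal.ofReal (dist z.1 z.2 ^ (2 * m)) := hF.div (by fun_prop)
        rw [lintegral_const_mul _ hmeas2, Measure.volume_eq_prod,
          lintegral_prod _ hmeas2.aemeasurable]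

lemma measurable_truncDist {N : Type} [PseudoMetricSpace N] [SecondCountableTopology N]
    [MeasurableSpace N] [BorelSpace N] {m : ℕ} {u : Euc m → N} (hu : Measurable u) (p δ : ℝ) :
    Measurable fun z : Euc m × Euc m =>
      ENNReal.ofReal (max (dist (u z.1) (u z.2) - δ) 0 ^ p) := by
  have hd : Measurable fun z : Euc m × Euc m => dist (u z.1) (u z.2) :=
    (hu.comp measurable_fst).dist (hu.comp measurable_snd)
  exact (((hd.sub_const δ).max measurable_const).pow_const p).ennreal_ofReal

lemma truncGagliardo_anti {N : Type} [PseudoMetricSpace N] {m : ℕ} {p : ℝ} (hp : 0 ≤ p)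
    {δ δ' : ℝ} (h : δ' ≤ δ) (u : Euc m → N) :
    truncGagliardo p δ u ≤ truncGagliardo p δ' u := by
  unfold truncGagliardo
  gcongr

lemma snd_pos_of_mem_frontier_cubeQ {m : ℕ} {lam τ : ℝ} {k : ℤ} (hlam : 1 < lam) (hτ : 0 < τ)
    {c : Fin m → ℝ} {x : Euc m × ℝ} (hx : x ∈ frontier (cubeQ m lam τ k c)) : 0 < x.2 := by
  have hQ : IsClosed (cubeQ m lam τ k c) := (isClosed_cube _ _).prod isClosed_Icc
  refine lt_of_lt_of_le ?_ (hQ.frontier_subset hx).2.1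
  have : 0 < lam ^ (-k) := zpow_pos (by linarith) _
  exact div_pos (mul_pos hτ this) (by linarith)

lemma iSup_frontier_MO_le {N : Type} [PseudoMetricSpace N] [SecondCountableTopology N]
    [MeasurableSpace N] [BorelSpace N] {m : ℕ} {u : Euc m → N} (hu : Measurable u) (p δ : ℝ)
    {lam : ℝ} (hlam : 2 ≤ lam) {τ : ℝ} (hτ : 0 < τ) (k : ℤ) (c : Fin m → ℝ) :
    ⨆ x ∈ frontier (cubeQ m lam τ k c), MO p δ u x.1 x.2 ≤
      ENNReal.ofReal (2 ^ (3 * m + 1) / (volume (ball (0 : Euc m) 1)).toReal ^ 3) *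
        ∫⁻ q in Ioi (0 : ℝ) ×ˢ (univ : Set (Euc m)),
          oscDensity (fun z => ENNReal.ofReal (max (dist (u z.1) (u z.2) - δ) 0 ^ p)) q *
            (nearBoundary m lam).indicator 1 (q, (τ * lam ^ (-k), c)) := by
  refine iSup₂_le fun x hx => ?_
  have hr : 0 < x.2 := snd_pos_of_mem_frontier_cubeQ (by linarith) hτ hx
  refine (average_ball_le_lintegral_oscDensity (measurable_truncDist hu p δ) x.1 hr).trans ?_
  gcongr 1
  calc ∫⁻ q in Icc x.2 (2 * x.2) ×ˢ ball x.1 x.2,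
        oscDensity (fun z => ENNReal.ofReal (max (dist (u z.1) (u z.2) - δ) 0 ^ p)) q
      = ∫⁻ q in Icc x.2 (2 * x.2) ×ˢ ball x.1 x.2,
        oscDensity (fun z => ENNReal.ofReal (max (dist (u z.1) (u z.2) - δ) 0 ^ p)) q *
            (nearBoundary m lam).indicator 1 (q, (τ * lam ^ (-k), c)) := by
        refine setLIntegral_congr_fun (measurableSet_Icc.prod measurableSet_ball) fun q hq => ?_
        have := mem_nearBoundary_of_mem_frontier hlam hτ hx hq.1 hq.2
        rw [indicator_of_mem this, Pi.one_apply, mul_one]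
    _ ≤ _ := lintegral_mono_set (prod_mono (fun ρ hρ => hr.trans_le hρ.1) (subset_univ _))

/-- Integrating a half-space density against the neighborhoods of the boundaries of all cubes,
averaged over positions and logarithmic scales. -/
lemma lintegral_lintegral_nearBoundary_le {m : ℕ} {lam : ℝ} (hlam : 1 < lam)
    {Φ : ℝ × Euc m → ℝ≥0∞} (hΦ : Measurable Φ) :
    ∫⁻ s in Ioi (0 : ℝ), (∫⁻ c : Fin m → ℝ, ∫⁻ q in Ioi (0 : ℝ) ×ˢ (univ : Set (Euc m)),
        Φ q * (nearBoundary m lam).indicator 1 (q, (s, c))) * ENNReal.ofReal s⁻¹ ≤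
      ENNReal.ofReal ((2 + 16 * m) * 9 ^ m) *
        ∫⁻ q in Ioi (0 : ℝ) ×ˢ (univ : Set (Euc m)), Φ q := by
  set A := nearBoundary m lam
  have hA : MeasurableSet A := measurableSet_nearBoundary m lam
  have hind : Measurable (A.indicator (1 : (ℝ × Euc m) × (ℝ × (Fin m → ℝ)) → ℝ≥0∞)) :=
    measurable_one.indicator hA
  have hinner : ∀ s : ℝ, ∫⁻ c : Fin m → ℝ, ∫⁻ q in Ioi (0 : ℝ) ×ˢ (univ : Set (Euc m)),
        Φ q * A.indicator 1 (q, (s, c)) =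
      ∫⁻ q in Ioi (0 : ℝ) ×ˢ (univ : Set (Euc m)), Φ q * volume {c | (q, (s, c)) ∈ A} := by
    intro s
    rw [lintegral_lintegral_swap (Measurable.aemeasurable
      ((hΦ.comp measurable_snd).mul (hind.comp (by fun_prop))))]
    refine lintegral_congr fun q => ?_
    have hAq : MeasurableSet {c | (q, (s, c)) ∈ A} :=
      hA.preimage (f := fun c : Fin m → ℝ => (q, (s, c))) (by fun_prop)
    have hindq : Measurable fun c : Fin m → ℝ =>
        A.indicator (1 : (ℝ × Euc m) × (ℝ × (Fin m → ℝ)) → ℝ≥0∞) (q, (s, c)) :=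
      hind.comp (by fun_prop)
    rw [lintegral_const_mul _ hindq, ← lintegral_indicator_one hAq]
    rfl
  have hvol : Measurable fun x : (ℝ × Euc m) × ℝ => volume {c | (x.1, (x.2, c)) ∈ A} := by
    have hpre : MeasurableSet ((fun x : ((ℝ × Euc m) × ℝ) × (Fin m → ℝ) =>
        (x.1.1, (x.1.2, x.2))) ⁻¹' A) := hA.preimage (by fun_prop)
    exact measurable_measure_prodMk_left hpre
  calc ∫⁻ s in Ioi (0 : ℝ), (∫⁻ c : Fin m → ℝ, ∫⁻ q in Ioi (0 : ℝ) ×ˢ (univ : Set (Euc m)),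
        Φ q * A.indicator 1 (q, (s, c))) * ENNReal.ofReal s⁻¹
      = ∫⁻ s in Ioi (0 : ℝ), ∫⁻ q in Ioi (0 : ℝ) ×ˢ (univ : Set (Euc m)),
          Φ q * (volume {c | (q, (s, c)) ∈ A} * ENNReal.ofReal s⁻¹) := by
        refine lintegral_congr fun s => ?_
        have hvols : Measurable fun q : ℝ × Euc m => volume {c | (q, (s, c)) ∈ A} :=
          hvol.comp (g := fun x : (ℝ × Euc m) × ℝ => volume {c | (x.1, (x.2, c)) ∈ A})
            (f := fun q => (q, s)) (by fun_prop)
        have hΦvol : Measurable fun q : ℝ × Euc m => Φ q * volume {c | (q, (s, c)) ∈ A} :=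
          hΦ.mul hvols
        rw [hinner s, ← lintegral_mul_const _ hΦvol]
        simp_rw [mul_assoc]
    _ = ∫⁻ q in Ioi (0 : ℝ) ×ˢ (univ : Set (Euc m)), ∫⁻ s in Ioi (0 : ℝ),
          Φ q * (volume {c | (q, (s, c)) ∈ A} * ENNReal.ofReal s⁻¹) :=
        lintegral_lintegral_swap (Measurable.aemeasurable ((hΦ.comp measurable_snd).mul
          ((hvol.comp measurable_swap).mul (by fun_prop))))
    _ ≤ ∫⁻ q in Ioi (0 : ℝ) ×ˢ (univ : Set (Euc m)),
          ENNReal.ofReal ((2 + 16 * m) * 9 ^ m) * Φ q := by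
        refine setLIntegral_mono' (measurableSet_Ioi.prod MeasurableSet.univ) fun q hq => ?_
        have hvolq : Measurable fun s : ℝ => volume {c | (q, (s, c)) ∈ A} :=
          hvol.comp (g := fun x : (ℝ × Euc m) × ℝ => volume {c | (x.1, (x.2, c)) ∈ A})
            (f := fun s => (q, s)) (by fun_prop)
        have hvolinv : Measurable fun s : ℝ =>
            volume {c | (q, (s, c)) ∈ A} * ENNReal.ofReal s⁻¹ := hvolq.mul (by fun_prop)
        rw [lintegral_const_mul _ hvolinv, mul_comm]
        gcongr
        exact lintegral_nearBoundary_le hlam hq.1 q.2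
    _ = _ := lintegral_const_mul _ hΦ

/-- Passing from sums over all lattice cubes, averaged over `τ` and `h`, to an integral over all
positions and logarithmic scales. -/
lemma lintegral_tsum_lattice_le {m : ℕ} {lam : ℝ} (hlam : 1 < lam) {g : ℝ → (Fin m → ℝ) → ℝ≥0∞}
    (hg : Measurable (Function.uncurry g)) {G : ℝ → ℤ → (Fin m → ℝ) → ℝ≥0∞}
    (hG : ∀ τ, 0 < τ → ∀ k c, G τ k c ≤ g (τ * lam ^ (-k)) c) :
    ∫⁻ τ in Ioc (1 : ℝ) lam, (∑' k : ℤ, ∫⁻ h in Icc (0 : Fin m → ℝ) 1, ∑' j : Fin m → ℤ,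
        G τ k (fun i => (j i : ℝ) + h i)) * ENNReal.ofReal τ⁻¹ ≤
      ∫⁻ s in Ioi (0 : ℝ), (∫⁻ c, g s c) * ENNReal.ofReal s⁻¹ := by
  have hgs : ∀ s, Measurable (g s) := fun s => hg.comp measurable_prodMk_left
  refine le_trans (setLIntegral_mono' measurableSet_Ioc fun τ hτ => ?_)
    (lintegral_Ioc_tsum_zpow_le (F := fun s => ∫⁻ c, g s c) hlam hg.lintegral_prod_right')
  refine mul_le_mul_left (ENNReal.tsum_le_tsum fun k => ?_) _
  refine le_trans ?_ (lintegral_Icc_tsum_int_translate_le (hgs (τ * lam ^ (-k))))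
  exact lintegral_mono fun h => ENNReal.tsum_le_tsum fun j => hG τ (one_pos.trans hτ.1) k _

/-- Proposition 2.3 (combined longitudinal and transversal estimate). -/
theorem combined_estimate (m : ℕ) (hm : 1 ≤ m) (p : ℝ) (hp : 1 ≤ p) :
    ∃ C : ℝ, 0 < C ∧
      ∀ (N : Type) [MetricSpace N] [CompactSpace N]
        [MeasurableSpace N] [BorelSpace N],
      ∀ (u : Euc m → N), Measurable u →
      ∀ (lam : ℝ), 2 ≤ lam →
      ∀ (δ : ℝ), 0 ≤ δ →
      (∫⁻ τ in Ioc (1 : ℝ) lam,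
        (∑' k : ℤ, ∫⁻ h in Icc (0 : Fin m → ℝ) 1,
          ∑' j : Fin m → ℤ,
            ⨆ x ∈ frontier (cubeQ m lam τ k (fun i => (j i : ℝ) + h i)),
              MO p δ u x.1 x.2)
          * ENNReal.ofReal τ⁻¹)
      ≤ ENNReal.ofReal C * truncGagliardo p (δ / 2) u := by
  set o := (volume (ball (0 : Euc m) 1)).toReal with ho
  have ho0 : 0 < o := volume_unit_ball_toReal_pos m
  set K : ℝ := 2 ^ (3 * m + 1) / o ^ 3
  set W : ℝ := (2 + 16 * m) * 9 ^ m
  set E : ℝ := 2 ^ m * o * 4 ^ (2 * m)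
  refine ⟨K * W * E, by positivity, ?_⟩
  intro N _ _ _ _ u hu lam hlam δ hδ
  set F : Euc m × Euc m → ℝ≥0∞ :=
    fun z => ENNReal.ofReal (max (dist (u z.1) (u z.2) - δ) 0 ^ p) with hFdef
  have hF : Measurable F := measurable_truncDist hu p δ
  have hdiag : ∀ y, F (y, y) = 0 := fun y => by
    simp only [hFdef, dist_self, zero_sub]
    rw [max_eq_right (by linarith), Real.zero_rpow (by linarith), ENNReal.ofReal_zero]
  have hΦ : Measurable fun q => ENNReal.ofReal K * oscDensity F q :=
    (measurable_oscDensity hF).const_mul _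
  have hgm : Measurable (Function.uncurry fun (s : ℝ) (c : Fin m → ℝ) =>
      ∫⁻ q in Ioi (0 : ℝ) ×ˢ (univ : Set (Euc m)),
        ENNReal.ofReal K * oscDensity F q * (nearBoundary m lam).indicator 1 (q, (s, c))) := by
    refine Measurable.lintegral_prod_left' (f := fun x : (ℝ × Euc m) × (ℝ × (Fin m → ℝ)) =>
      ENNReal.ofReal K * oscDensity F x.1 * (nearBoundary m lam).indicator 1 x) ?_
    exact (hΦ.comp measurable_fst).mul
      (measurable_one.indicator (measurableSet_nearBoundary m lam))
  refine (lintegral_tsum_lattice_le (by linarith) hgm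
    (G := fun τ k c => ⨆ x ∈ frontier (cubeQ m lam τ k c), MO p δ u x.1 x.2)
    fun τ hτ k c => ?_).trans ?_
  · refine (iSup_frontier_MO_le hu p δ hlam hτ k c).trans_eq ?_
    rw [← lintegral_const_mul' _ _ ENNReal.ofReal_ne_top]
    simp_rw [mul_assoc]
    rfl
  have hKWE : ENNReal.ofReal (K * W * E) =
      ENNReal.ofReal K * ENNReal.ofReal W * ENNReal.ofReal E := by
    rw [ENNReal.ofReal_mul (by positivity), ENNReal.ofReal_mul (by positivity)]
  refine (lintegral_lintegral_nearBoundary_le (by linarith) hΦ).trans ?_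
  rw [lintegral_const_mul' _ _ ENNReal.ofReal_ne_top, hKWE, mul_left_comm, mul_assoc, mul_assoc]
  refine mul_le_mul' le_rfl (mul_le_mul' le_rfl ?_)
  refine (lintegral_oscDensity_le hm hF hdiag).trans (mul_le_mul' le_rfl ?_)
  exact truncGagliardo_anti (by linarith) (by linarith) u
end
end
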